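/- arXiv:2012.08346 — 2 statements merged into one kernel-verified Lean document; each statement's English description precedes it below -/
import Mathlib

section
/- Let n ≥ 100d and let W = (W₁, …, W_n) ∈ ℝ^{d×n} be a random matrix whose columns are independent logconcave random vectors in ℝ^d, each with identity covariance matrix. Then P[ max over unit vectors u ∈ ℝ^d of ‖uᵀ(W − E[W])‖₁ ≥ 4n ] ≤ e^{−n/5}, where ‖uᵀ(W − E[W])‖₁ = Σ_{i=1}^n |uᵀ(W_i − E[W_i])|. -/
open MeasureTheory ProbabilityTheory ENNReal

/-- A random vector in `ℝ^d` (with law `μ`) is logconcave if its law has a density `f ≥ 0`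
w.r.t. Lebesgue measure such that `log f` is concave, i.e.
`f(x)^t · f(y)^{1−t} ≤ f(tx + (1−t)y)` for all `x, y` and `t ∈ [0,1]`. -/
def IsLogConcave {d : ℕ} (μ : Measure (Fin d → ℝ)) : Prop :=
  ∃ f : (Fin d → ℝ) → ℝ, (∀ x, 0 ≤ f x) ∧
    μ = MeasureTheory.volume.withDensity (fun x => ENNReal.ofReal (f x)) ∧
    ∀ x y : Fin d → ℝ, ∀ t : ℝ, 0 ≤ t → t ≤ 1 →
      f x ^ t * f y ^ (1 - t) ≤ f (t • x + (1 - t) • y)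

/-- A random vector in `ℝ^d` (with law `μ`) has identity covariance. -/
def HasIdCovariance {d : ℕ} (μ : Measure (Fin d → ℝ)) : Prop :=
  ∀ i j : Fin d,
    (∫ x, x i * x j ∂μ) - (∫ x, x i ∂μ) * (∫ x, x j ∂μ) = if i = j then 1 else 0

lemma bm_compact (K L C : Set ℝ) (hK : IsCompact K) (hL : IsCompact L) (hKn : K.Nonempty)
    (hLn : L.Nonempty) (h : ∀ x ∈ K, ∀ y ∈ L, (1/2:ℝ) * (x + y) ∈ C) :
    volume K + volume L ≤ 2 * volume C := by
  obtain ⟨a, haK, ha⟩ := hK.exists_isGreatest hKn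
  obtain ⟨b, hbL, hb⟩ := hL.exists_isLeast hLn
  have hD : volume ((fun x => (1/2:ℝ) * x) ⁻¹' C) = 2 * volume C := by
    rw [Real.volume_preimage_mul_left (by norm_num)]
    congr 1
    norm_num
  rw [← hD]
  have e1 : volume K = volume ((fun x => x + b) '' K) := by
    rw [Set.image_add_right, measure_preimage_add_right]
  have e2 : volume L = volume ((fun x => a + x) '' L) := by
    rw [Set.image_add_left, measure_preimage_add]
  rw [e1, e2, ← measure_union₀]
  · apply measure_mono
    rintro z (⟨x, hx, rfl⟩ | ⟨y, hy, rfl⟩)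
    · exact h x hx b hbL
    · exact h a haK y hy
  · exact ((hL.image (by fun_prop)).measurableSet).nullMeasurableSet
  · refine measure_mono_null (t := {a + b}) ?_ (by simp)
    rintro z ⟨⟨x, hx, rfl⟩, ⟨y, hy, hxy⟩⟩
    have := ha hx
    have := hb hy
    simp only [Set.mem_singleton_iff]
    simp only at hxy
    linarith

lemma bm_meas (A B C : Set ℝ) (hA : MeasurableSet A) (hB : MeasurableSet B) (hAn : A.Nonempty)
    (hBn : B.Nonempty) (h : ∀ x ∈ A, ∀ y ∈ B, (1/2:ℝ) * (x + y) ∈ C) :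
    volume A + volume B ≤ 2 * volume C := by
  obtain ⟨a0, ha0⟩ := hAn
  obtain ⟨b0, hb0⟩ := hBn
  rw [hA.measure_eq_iSup_isCompact, hB.measure_eq_iSup_isCompact]
  simp only [iSup_and']
  refine ENNReal.biSup_add_biSup_le' (p := fun K => K ⊆ A ∧ IsCompact K)
    (q := fun K => K ⊆ B ∧ IsCompact K) ⟨∅, by simp, isCompact_empty⟩ ⟨∅, by simp, isCompact_empty⟩ ?_
  rintro K ⟨hKA, hK⟩ L ⟨hLB, hL⟩
  calc volume K + volume L ≤ volume (insert a0 K) + volume (insert b0 L) := by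
        gcongr <;> exact Set.subset_insert _ _
    _ ≤ _ := by
      apply bm_compact _ _ _ (hK.insert a0) (hL.insert b0) (Set.insert_nonempty _ _)
        (Set.insert_nonempty _ _)
      intro x hx y hy
      exact h x (Set.insert_subset ha0 hKA hx) y (Set.insert_subset hb0 hLB hy)

lemma layer_aux (c : ℝ≥0∞) : volume {t : ℝ | 0 < t ∧ ENNReal.ofReal t < c} = c := by
  by_cases hc : c = ⊤
  · subst hc
    simp only [ENNReal.ofReal_lt_top, and_true]
    exact Real.volume_Ioi
  · have : {t : ℝ | 0 < t ∧ ENNReal.ofReal t < c} = Set.Ioo 0 c.toReal := by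
      ext t
      simp only [Set.mem_ofPred_eq, Set.mem_Ioo]
      refine and_congr_right fun ht => ?_
      rw [ENNReal.ofReal_lt_iff_lt_toReal ht.le hc]
    rw [this, Real.volume_Ioo]
    simp [hc]

lemma layer (F : ℝ → ℝ≥0∞) (hF : Measurable F) :
    ∫⁻ x, F x = ∫⁻ t in Set.Ioi (0:ℝ), volume {x | ENNReal.ofReal t < F x} := by
  let S : Set (ℝ × ℝ) := {p | ENNReal.ofReal p.1 < F p.2}
  have hS : MeasurableSet S := measurableSet_lt (by fun_prop) (by fun_prop)
  have h1 : ∀ t : ℝ, volume {x | ENNReal.ofReal t < F x}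
      = ∫⁻ x, S.indicator 1 (t, x) := by
    intro t
    rw [← lintegral_indicator_one]
    · rfl
    · exact measurableSet_lt (by fun_prop) (by fun_prop)
  simp_rw [h1]
  rw [lintegral_lintegral_swap]
  · congr 1
    ext x
    have h2 : ∀ t : ℝ, S.indicator (1 : ℝ × ℝ → ℝ≥0∞) (t, x)
      = {t | ENNReal.ofReal t < F x}.indicator 1 t := fun t => rfl
    simp_rw [h2]
    have hm : MeasurableSet {t | ENNReal.ofReal t < F x} :=
      measurableSet_lt (by fun_prop) (by fun_prop)
    rw [lintegral_indicator_one hm, Measure.restrict_apply hm]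
    refine (layer_aux (F x)).symm.trans ?_
    congr 1
    ext t
    simp [and_comm]
  · exact ((measurable_one.indicator hS)).aemeasurable

lemma four_mul_le (a b : ℝ≥0∞) : 4 * (a * b) ≤ (a + b) ^ 2 := by
  wlog hab : a ≤ b generalizing a b
  · rw [mul_comm a b, add_comm a b]; exact this b a (le_of_not_ge hab)
  obtain ⟨c, rfl⟩ := le_iff_exists_add.1 hab
  refine le_iff_exists_add.2 ⟨c ^ 2, by ring⟩

/-- normalised one dimensional Prekopa–Leindler -/
lemma pl_one_norm (f g h : ℝ → ℝ≥0∞) (hf : Measurable f) (hg : Measurable g) (hh : Measurable h)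
    (hf1 : ⨆ x, f x = 1) (hg1 : ⨆ x, g x = 1)
    (H : ∀ x y, f x * g y ≤ h ((1/2:ℝ) * (x + y)) ^ 2) :
    (∫⁻ x, f x) * (∫⁻ x, g x) ≤ (∫⁻ x, h x) ^ 2 := by
  have key : (∫⁻ x, f x) + (∫⁻ x, g x) ≤ 2 * ∫⁻ x, h x := by
    rw [layer f hf, layer g hg, layer h hh]
    have hm : ∀ F : ℝ → ℝ≥0∞, Measurable fun t : ℝ => volume {x | ENNReal.ofReal t < F x} := by
      intro F
      apply Antitone.measurable
      intro s t hst
      apply measure_mono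
      intro x hx
      exact lt_of_le_of_lt (ENNReal.ofReal_le_ofReal hst) hx
    rw [← lintegral_add_left (hm f), ← lintegral_const_mul _ (hm h)]
    apply setLIntegral_mono' measurableSet_Ioi
    intro t ht
    by_cases ht1 : t < 1
    · have ht1' : ENNReal.ofReal t < 1 := by
        rw [ENNReal.ofReal_lt_one]; exact ht1
      apply bm_meas
      · exact measurableSet_lt (by fun_prop) (by fun_prop)
      · exact measurableSet_lt (by fun_prop) (by fun_prop)
      · rw [← hf1] at ht1'
        exact lt_iSup_iff.1 ht1'
      · rw [← hg1] at ht1'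
        exact lt_iSup_iff.1 ht1'
      · intro x hx y hy
        simp only [Set.mem_ofPred_eq] at hx hy ⊢
        by_contra hcon
        have h3 := (ENNReal.mul_lt_mul hx hy).trans_le (H x y)
        rw [← sq] at h3
        exact absurd h3 (not_lt.2 (pow_le_pow_left' (not_lt.1 hcon) 2))
    · have ht1' : 1 ≤ ENNReal.ofReal t := by
        rw [ENNReal.one_le_ofReal]; exact not_lt.1 ht1
      have : ∀ F : ℝ → ℝ≥0∞, (⨆ x, F x = 1) → {x | ENNReal.ofReal t < F x} = ∅ := by
        intro F hF
        ext x
        simp only [Set.mem_ofPred_eq, Set.mem_empty_iff_false, iff_false, not_lt]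
        exact ((le_iSup F x).trans hF.le).trans ht1'
      rw [this f hf1, this g hg1]
      simp
  have h4 := (four_mul_le (∫⁻ x, f x) (∫⁻ x, g x)).trans (pow_le_pow_left' key 2)
  rw [mul_pow] at h4
  have : (2:ℝ≥0∞) ^ 2 = 4 := by norm_num
  rw [this] at h4
  exact (ENNReal.mul_le_mul_iff_right (by norm_num) (by norm_num)).1 h4

lemma pl_one_bdd (f g h : ℝ → ℝ≥0∞) (hf : Measurable f) (hg : Measurable g) (hh : Measurable h)
    (hf1 : ⨆ x, f x ≠ ⊤) (hg1 : ⨆ x, g x ≠ ⊤)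
    (H : ∀ x y, f x * g y ≤ h ((1/2:ℝ) * (x + y)) ^ 2) :
    (∫⁻ x, f x) * (∫⁻ x, g x) ≤ (∫⁻ x, h x) ^ 2 := by
  set a := ⨆ x, f x with ha
  set b := ⨆ x, g x with hb
  by_cases ha0 : a = 0
  · have : ∀ x, f x = 0 := fun x => le_antisymm ((le_iSup f x).trans ha0.le) zero_le
    simp [this]
  by_cases hb0 : b = 0
  · have : ∀ x, g x = 0 := fun x => le_antisymm ((le_iSup g x).trans hb0.le) zero_le
    simp [this]
  have hab0 : a * b ≠ 0 := mul_ne_zero ha0 hb0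
  have habt : a * b ≠ ⊤ := ENNReal.mul_ne_top hf1 hg1
  obtain ⟨s, hs⟩ : ∃ s : ℝ≥0∞, s ^ 2 = a * b :=
    ⟨(a * b) ^ (1/2:ℝ), by rw [← ENNReal.rpow_natCast, ← ENNReal.rpow_mul]; norm_num⟩
  have hs0 : s ≠ 0 := by rintro rfl; simp at hs; exact (hs.elim ha0 hb0)
  have hst : s ≠ ⊤ := by rintro rfl; simp at hs; exact habt hs.symm
  have := pl_one_norm (fun x => a⁻¹ * f x) (fun x => b⁻¹ * g x) (fun x => s⁻¹ * h x)
    (by fun_prop) (by fun_prop) (by fun_prop)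
    (by rw [← ENNReal.mul_iSup, ← ha, ENNReal.inv_mul_cancel ha0 hf1])
    (by rw [← ENNReal.mul_iSup, ← hb, ENNReal.inv_mul_cancel hb0 hg1])
    (by
      intro x y
      calc a⁻¹ * f x * (b⁻¹ * g y) = (a⁻¹ * b⁻¹) * (f x * g y) := by ring
        _ ≤ (a⁻¹ * b⁻¹) * h ((1/2:ℝ) * (x + y)) ^ 2 := by gcongr; exact H x y
        _ = _ := by
          rw [mul_pow, ← ENNReal.inv_pow, hs, ENNReal.mul_inv (Or.inl ha0) (Or.inl hf1)])
  rw [lintegral_const_mul _ hf, lintegral_const_mul _ hg, lintegral_const_mul _ hh, mul_pow,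
    ← ENNReal.inv_pow, hs] at this
  have h5 : (a * b)⁻¹ * ((∫⁻ x, f x) * (∫⁻ x, g x)) ≤ (a * b)⁻¹ * (∫⁻ x, h x) ^ 2 := by
    rw [ENNReal.mul_inv (Or.inl ha0) (Or.inl hf1)] at this ⊢
    calc _ = _ := by ring
      _ ≤ _ := this
  exact (ENNReal.mul_le_mul_iff_right (ENNReal.inv_ne_zero.2 habt) (ENNReal.inv_ne_top.2 hab0)).1 h5

lemma trunc (f : ℝ → ℝ≥0∞) (hf : Measurable f) :
    ∫⁻ x, f x = ⨆ k : ℕ, ∫⁻ x, min (f x) k := by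
  rw [← lintegral_iSup (fun k => by fun_prop)]
  · congr 1
    ext x
    rw [← inf_iSup_eq, ENNReal.iSup_natCast, inf_top_eq]
  · intro i j hij x
    simp only
    gcongr

lemma pl_one (f g h : ℝ → ℝ≥0∞) (hf : Measurable f) (hg : Measurable g) (hh : Measurable h)
    (H : ∀ x y, f x * g y ≤ h ((1/2:ℝ) * (x + y)) ^ 2) :
    (∫⁻ x, f x) * (∫⁻ x, g x) ≤ (∫⁻ x, h x) ^ 2 := by
  rw [trunc f hf, trunc g hg, ENNReal.iSup_mul]
  refine iSup_le fun k => ?_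
  rw [ENNReal.mul_iSup]
  refine iSup_le fun l => ?_
  refine pl_one_bdd (fun x => min (f x) k) (fun x => min (g x) l) h (by fun_prop) (by fun_prop) hh ?_ ?_ ?_
  · exact ne_top_of_le_ne_top (ENNReal.natCast_ne_top k) (iSup_le fun x => min_le_right _ _)
  · exact ne_top_of_le_ne_top (ENNReal.natCast_ne_top l) (iSup_le fun x => min_le_right _ _)
  · intro x y
    exact (mul_le_mul' (min_le_left _ _) (min_le_left _ _)).trans (H x y)

lemma lintegral_succ (d : ℕ) (f : (Fin (d+1) → ℝ) → ℝ≥0∞) (hf : Measurable f) :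
    ∫⁻ x, f x = ∫⁻ s : ℝ, ∫⁻ y : Fin d → ℝ, f (Fin.cons s y) := by
  have hmp := (volume_preserving_piFinSuccAbove (fun _ : Fin (d+1) => ℝ) 0).symm
  rw [← hmp.lintegral_comp hf]
  rw [Measure.volume_eq_prod, lintegral_prod]
  · simp [MeasurableEquiv.piFinSuccAbove, Fin.insertNthEquiv, Fin.insertNth_zero']
  · exact (hf.comp (MeasurableEquiv.measurable _)).aemeasurable

lemma measurable_cons (d : ℕ) : Measurable (fun p : ℝ × (Fin d → ℝ) => (Fin.cons p.1 p.2 : Fin (d+1) → ℝ)) := by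
  rw [measurable_pi_iff]
  intro i
  refine Fin.cases ?_ (fun i => ?_) i
  · simpa using measurable_fst
  · simp only [Fin.cons_succ]; fun_prop

lemma pl (d : ℕ) : ∀ (f g h : (Fin d → ℝ) → ℝ≥0∞), Measurable f → Measurable g → Measurable h →
    (∀ x y, f x * g y ≤ h ((1/2:ℝ) • (x + y)) ^ 2) →
    (∫⁻ x, f x) * (∫⁻ x, g x) ≤ (∫⁻ x, h x) ^ 2 := by
  induction d with
  | zero =>
    intro f g h hf hg hh H
    rw [lintegral_unique, lintegral_unique, lintegral_unique]
    have : (volume : Measure (Fin 0 → ℝ)) Set.univ = 1 := by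
      rw [volume_pi, Measure.pi_univ]; simp
    rw [this]
    simp only [mul_one]
    convert H default default
  | succ d ih =>
    intro f g h hf hg hh H
    have hm : ∀ F : (Fin (d+1) → ℝ) → ℝ≥0∞, Measurable F →
        Measurable fun s : ℝ => ∫⁻ y : Fin d → ℝ, F (Fin.cons s y) := by
      intro F hF
      exact Measurable.lintegral_prod_right' (hF.comp (measurable_cons d))
    have hm' : ∀ F : (Fin (d+1) → ℝ) → ℝ≥0∞, Measurable F → ∀ s : ℝ,
        Measurable fun y : Fin d → ℝ => F (Fin.cons s y) := by
      intro F hF s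
      exact (hF.comp (measurable_cons d)).comp measurable_prodMk_left
    rw [lintegral_succ d f hf, lintegral_succ d g hg, lintegral_succ d h hh]
    apply pl_one _ _ _ (hm f hf) (hm g hg) (hm h hh)
    intro s t
    apply ih _ _ _ (hm' f hf s) (hm' g hg t) (hm' h hh _)
    intro x y
    convert H (Fin.cons s x) (Fin.cons t y) using 3
    ext i
    refine Fin.cases ?_ (fun i => ?_) i <;> simp [mul_add]

lemma convex_superlevel {d : ℕ} (f : (Fin d → ℝ) → ℝ)
    (hlc : ∀ x y : Fin d → ℝ, ∀ t : ℝ, 0 ≤ t → t ≤ 1 →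
      f x ^ t * f y ^ (1 - t) ≤ f (t • x + (1 - t) • y)) (q : NNReal) :
    Convex ℝ {z | (q:ℝ) < f z} := by
  intro x hx y hy a b ha hb hab
  simp only [Set.mem_ofPred_eq] at hx hy ⊢
  obtain rfl : b = 1 - a := by linarith
  refine lt_of_lt_of_le ?_ (hlc x y a ha (by linarith))
  have hq : (0:ℝ) ≤ q := q.2
  rcases ha.eq_or_lt with rfl | ha'
  · simpa using hy
  have h1 : (q:ℝ) = (q:ℝ) ^ a * (q:ℝ) ^ (1 - a) := by
    rw [← Real.rpow_add_of_nonneg hq ha hb]; simp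
  rw [h1]
  have h2 : (q:ℝ) ^ a < f x ^ a := Real.rpow_lt_rpow hq hx ha'
  have h3 : (q:ℝ) ^ (1-a) ≤ f y ^ (1-a) := Real.rpow_le_rpow hq hy.le hb
  have h4 : 0 < f y ^ (1-a) := Real.rpow_pos_of_pos (hq.trans_lt hy) _
  have h5 : 0 ≤ (q:ℝ) ^ a := Real.rpow_nonneg hq _
  calc _ ≤ (q:ℝ) ^ a * f y ^ (1-a) := by gcongr
    _ < _ := by gcongr

lemma reg {d : ℕ} (f : (Fin d → ℝ) → ℝ) (hf : ∀ x, 0 ≤ f x)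
    (hlc : ∀ x y : Fin d → ℝ, ∀ t : ℝ, 0 ≤ t → t ≤ 1 →
      f x ^ t * f y ^ (1 - t) ≤ f (t • x + (1 - t) • y)) :
    ∃ g : (Fin d → ℝ) → ℝ≥0∞, Measurable g ∧
      (fun x => ENNReal.ofReal (f x)) =ᵐ[volume] g ∧
      ∀ x y, g x * g y ≤ g ((1/2:ℝ) • (x + y)) ^ 2 := by
  let S : NNReal → Set (Fin d → ℝ) := fun q => interior {z | (q:ℝ) < f z}
  let g : (Fin d → ℝ) → ℝ≥0∞ := fun x => ⨆ q : NNReal, ⨆ (_ : x ∈ S q), (q : ℝ≥0∞)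
  have hlt : ∀ x c, c < g x ↔ ∃ q : NNReal, x ∈ S q ∧ c < q := by
    intro x c
    simp only [g, lt_iSup_iff, exists_prop]
  refine ⟨g, ?_, ?_, ?_⟩
  · apply measurable_of_Ioi
    intro c
    apply IsOpen.measurableSet
    have : g ⁻¹' Set.Ioi c = ⋃ q : NNReal, ⋃ (_ : c < q), S q := by
      ext x
      simp only [Set.mem_preimage, Set.mem_Ioi, hlt, Set.mem_iUnion, exists_prop]
      tauto
    rw [this]
    exact isOpen_iUnion fun q => isOpen_iUnion fun _ => isOpen_interior
  · have hnull : volume (⋃ q : ℚ, frontier {z | ((Real.toNNReal q : NNReal) : ℝ) < f z}) = 0 := by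
      rw [measure_iUnion_null_iff]
      intro q
      exact (convex_superlevel f hlc _).addHaar_frontier volume
    rw [Filter.EventuallyEq, ae_iff]
    refine measure_mono_null ?_ hnull
    intro x hx
    simp only [Set.mem_ofPred_eq] at hx
    have hle : g x ≤ ENNReal.ofReal (f x) := by
      refine iSup_le fun q => iSup_le fun hq => ?_
      have := interior_subset hq
      simp only [Set.mem_ofPred_eq] at this
      rw [← ENNReal.ofReal_coe_nnreal]
      exact ENNReal.ofReal_le_ofReal this.le
    have hlt' := lt_of_le_of_ne hle (Ne.symm hx)
    obtain ⟨r, hr0, hr1, hr2⟩ := ENNReal.lt_iff_exists_rat_btwn.1 hlt'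
    have hr3 : ((Real.toNNReal r : NNReal) : ℝ) < f x := by
      rw [Real.coe_toNNReal _ (by exact_mod_cast hr0)]
      have h := ((ENNReal.ofReal_lt_ofReal_iff_of_nonneg (by exact_mod_cast hr0)).1 hr2)
      exact h
    rw [Set.mem_iUnion]
    refine ⟨r, subset_closure hr3, fun hint => ?_⟩
    have h6 : ((Real.toNNReal r : NNReal) : ℝ≥0∞) ≤ g x :=
      le_iSup₂_of_le (f := fun (q : NNReal) (_ : x ∈ S q) => (q : ℝ≥0∞)) (Real.toNNReal r) hint le_rfl
    exact absurd hr1 (not_lt.2 h6)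
  · intro x y
    apply ENNReal.mul_le_of_forall_lt
    intro a ha b hb
    obtain ⟨p, hp, hap⟩ := (hlt _ _).1 ha
    obtain ⟨q, hq, hbq⟩ := (hlt _ _).1 hb
    have hmem : (1/2:ℝ) • (x + y) ∈ S (NNReal.sqrt (p * q)) := by
      rw [mem_interior_iff_mem_nhds, Metric.mem_nhds_iff]
      rw [mem_interior_iff_mem_nhds, Metric.mem_nhds_iff] at hp hq
      obtain ⟨e1, he1, hp⟩ := hp
      obtain ⟨e2, he2, hq⟩ := hq
      refine ⟨min e1 e2, lt_min he1 he2, ?_⟩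
      intro z hz
      rw [Metric.mem_ball, dist_eq_norm] at hz
      set w := z - (1/2:ℝ) • (x + y) with hw
      have h1 : x + w ∈ {z | (p:ℝ) < f z} := by
        apply hp; rw [Metric.mem_ball, dist_eq_norm]; simpa using hz.trans_le (min_le_left _ _)
      have h2 : y + w ∈ {z | (q:ℝ) < f z} := by
        apply hq; rw [Metric.mem_ball, dist_eq_norm]; simpa using hz.trans_le (min_le_right _ _)
      simp only [Set.mem_ofPred_eq] at h1 h2 ⊢
      have h3 := hlc (x + w) (y + w) (1/2) (by norm_num) (by norm_num)
      have h4 : (1/2:ℝ) • (x + w) + (1 - 1/2 : ℝ) • (y + w) = z := by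
        rw [hw]; ext i; simp; ring
      rw [h4] at h3
      refine lt_of_lt_of_le ?_ h3
      rw [show (1 - 1/2 : ℝ) = 1/2 by norm_num, ← Real.sqrt_eq_rpow, ← Real.sqrt_eq_rpow,
        ← Real.sqrt_mul (hf _)]
      rw [Real.coe_sqrt]
      apply Real.sqrt_lt_sqrt
      · positivity
      · push_cast
        exact mul_lt_mul'' h1 h2 p.2 q.2
    have h7 : ((NNReal.sqrt (p * q) : NNReal) : ℝ≥0∞) ≤ g ((1/2:ℝ) • (x + y)) :=
      le_iSup₂_of_le (f := fun (q : NNReal) (_ : _ ∈ S q) => (q : ℝ≥0∞)) _ hmem le_rfl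
    calc a * b ≤ (p:ℝ≥0∞) * q := mul_le_mul' hap.le hbq.le
      _ = ((NNReal.sqrt (p * q) : NNReal) : ℝ≥0∞) ^ 2 := by
        rw [← ENNReal.coe_pow, NNReal.sq_sqrt, ENNReal.coe_mul]
      _ ≤ _ := by gcongr

lemma tail_mid {d : ℕ} (μ : Measure (Fin d → ℝ)) (h : IsLogConcave μ) (v : Fin d → ℝ) (a b : ℝ) :
    μ {x | a ≤ ∑ j, v j * x j} * μ {x | b ≤ ∑ j, v j * x j}
      ≤ μ {x | (a + b) / 2 ≤ ∑ j, v j * x j} ^ 2 := by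
  obtain ⟨f, hf, hμ, hlc⟩ := h
  obtain ⟨g, hg, hfg, hgl⟩ := reg f hf hlc
  rw [withDensity_congr_ae hfg] at hμ
  have hm : ∀ c : ℝ, MeasurableSet {x : Fin d → ℝ | c ≤ ∑ j, v j * x j} := fun c =>
    measurableSet_le (by fun_prop) (by fun_prop)
  rw [hμ, withDensity_apply _ (hm _), withDensity_apply _ (hm _), withDensity_apply _ (hm _),
    ← lintegral_indicator (hm _), ← lintegral_indicator (hm _), ← lintegral_indicator (hm _)]
  apply pl d _ _ _ (hg.indicator (hm _)) (hg.indicator (hm _)) (hg.indicator (hm _))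
  intro x y
  by_cases hx : a ≤ ∑ j, v j * x j
  · by_cases hy : b ≤ ∑ j, v j * y j
    · have hz : (a + b) / 2 ≤ ∑ j, v j * ((1/2:ℝ) • (x + y)) j := by
        have : ∑ j, v j * ((1/2:ℝ) • (x + y)) j = (∑ j, v j * x j + ∑ j, v j * y j) / 2 := by
          rw [← Finset.sum_add_distrib, Finset.sum_div]
          refine Finset.sum_congr rfl fun j _ => ?_
          simp only [Pi.smul_apply, Pi.add_apply, smul_eq_mul]
          ring
        rw [this]; linarith
      rw [Set.indicator_of_mem (by exact hx), Set.indicator_of_mem (by exact hy),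
        Set.indicator_of_mem (by exact hz)]
      exact hgl x y
    · rw [Set.indicator_of_notMem (s := {x : Fin d → ℝ | b ≤ ∑ j, v j * x j}) hy]; simp
  · rw [Set.indicator_of_notMem (s := {x : Fin d → ℝ | a ≤ ∑ j, v j * x j}) hx]; simp

lemma geom (T : ℕ → ℝ) (h0 : ∀ k, 0 ≤ T k) (hanti : ∀ k, T (k+1) ≤ T k)
    (hb : 3 * T 1 ≤ T 0) (hm : ∀ k, T k * T (k+2) ≤ T (k+1) ^ 2) (k : ℕ) :
    T (k+1) ≤ T 1 * (1/3) ^ k := by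
  have h3 : ∀ k, 3 * T (k+1) ≤ T k := by
    intro k
    induction k with
    | zero => exact hb
    | succ k ih =>
      rcases (h0 k).eq_or_lt with hk | hk
      · have := hanti k; have := hanti (k+1); have := h0 (k+2); have := h0 (k+1)
        have e : k + 1 + 1 = k + 2 := rfl
        rw [e] at *
        linarith
      · have h := hm k
        have h' : T (k+1) ^ 2 ≤ T (k+1) * (T k / 3) := by
          rw [sq]; exact mul_le_mul_of_nonneg_left (by linarith) (h0 _)
        have : T k * (3 * T (k+2)) ≤ T k * T (k+1) := by nlinarith
        exact le_of_mul_le_mul_left this hk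
  induction k with
  | zero => simp
  | succ k ih =>
    have := h3 (k+1)
    rw [pow_succ]
    linarith

/-- one sided tail -/
lemma tail_one {d : ℕ} (μ : Measure (Fin d → ℝ)) [IsProbabilityMeasure μ] (h : IsLogConcave μ)
    (v : Fin d → ℝ) (c : ℝ)
    (hb : 3 * μ.real {x | 1/4 ≤ (∑ j, v j * x j) - c} ≤ μ.real {x | -1/4 ≤ (∑ j, v j * x j) - c})
    (k : ℕ) :
    μ.real {x | 1/4 + (k:ℝ)/2 ≤ (∑ j, v j * x j) - c}
      ≤ μ.real {x | 1/4 ≤ (∑ j, v j * x j) - c} * (1/3) ^ k := by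
  set S : ℝ → ℝ := fun a => μ.real {x | a ≤ (∑ j, v j * x j) - c} with hS
  have := geom (fun k : ℕ => S (-1/4 + (k:ℝ)/2)) (fun k => measureReal_nonneg) ?_ ?_ ?_ k
  · have e1 : -1/4 + ((k+1:ℕ):ℝ)/2 = 1/4 + (k:ℝ)/2 := by push_cast; ring
    have e2 : -1/4 + ((1:ℕ):ℝ)/2 = 1/4 := by push_cast; ring
    simp only [e1, e2] at this
    exact this
  · intro k
    apply measureReal_mono
    · intro x hx
      simp only [Set.mem_ofPred_eq] at hx ⊢
      push_cast at hx
      linarith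
    · exact measure_ne_top _ _
  · have e1 : -1/4 + ((0:ℕ):ℝ)/2 = -1/4 := by push_cast; ring
    have e2 : -1/4 + ((1:ℕ):ℝ)/2 = 1/4 := by push_cast; ring
    simp only [e1, e2]
    exact hb
  · intro k
    have h1 := tail_mid μ h v (c + (-1/4 + (k:ℝ)/2)) (c + (-1/4 + ((k+2:ℕ):ℝ)/2))
    have h2 := ENNReal.toReal_mono (by simp) h1
    rw [ENNReal.toReal_mul, ENNReal.toReal_pow] at h2
    have e : (c + (-1/4 + (k:ℝ)/2) + (c + (-1/4 + ((k+2:ℕ):ℝ)/2))) / 2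
      = c + (-1/4 + ((k+1:ℕ):ℝ)/2) := by push_cast; ring
    rw [e] at h2
    simp only [hS, le_sub_iff_add_le']
    exact h2

lemma memLp_coord {d : ℕ} (μ : Measure (Fin d → ℝ)) [IsProbabilityMeasure μ]
    (h : HasIdCovariance μ) (j : Fin d) : MemLp (fun x : Fin d → ℝ => x j) 2 μ := by
  rw [memLp_two_iff_integrable_sq (measurable_pi_apply j).aestronglyMeasurable]
  by_contra hcon
  have h1 := h j j
  have h2 : ∫ x, x j * x j ∂μ = 0 := by
    apply integral_undef
    simpa only [sq] using hcon
  rw [h2] at h1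
  simp only [if_true] at h1
  nlinarith [mul_self_nonneg (∫ x, x j ∂μ)]

lemma second_moment {d : ℕ} (μ : Measure (Fin d → ℝ)) [IsProbabilityMeasure μ]
    (h : HasIdCovariance μ) (v : Fin d → ℝ) :
    Integrable (fun x : Fin d → ℝ => (∑ j, v j * (x j - ∫ y, y j ∂μ)) ^ 2) μ ∧
    ∫ x, (∑ j, v j * (x j - ∫ y, y j ∂μ)) ^ 2 ∂μ = ∑ j, v j ^ 2 := by
  have hL := memLp_coord μ h
  set m : Fin d → ℝ := fun j => ∫ y, y j ∂μ with hm
  have hL' : ∀ j, MemLp (fun x : Fin d → ℝ => x j - m j) 2 μ := fun j =>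
    (hL j).sub (memLp_const _)
  have hI : ∀ j, Integrable (fun x : Fin d → ℝ => x j) μ := fun j =>
    (hL j).integrable (by norm_num)
  have hII : ∀ i j, Integrable (fun x : Fin d → ℝ => x i * x j) μ := fun i j =>
    (hL i).integrable_mul (hL j)
  have hII' : ∀ i j, Integrable (fun x : Fin d → ℝ => (x i - m i) * (x j - m j)) μ := fun i j =>
    (hL' i).integrable_mul (hL' j)
  have hc : ∀ i j, ∫ x, (x i - m i) * (x j - m j) ∂μ = if i = j then 1 else 0 := by
    intro i j
    rw [← h i j]
    have : ∀ x : Fin d → ℝ, (x i - m i) * (x j - m j)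
      = x i * x j - m j * x i - m i * x j + m i * m j := fun x => by ring
    simp_rw [this]
    rw [integral_add, integral_sub, integral_sub, integral_const_mul, integral_const_mul]
    · simp only [integral_const, probReal_univ, hm, smul_eq_mul]
      ring
    · exact hII i j
    · exact (hI i).const_mul _
    · exact (hII i j).sub ((hI i).const_mul _)
    · exact (hI j).const_mul _
    · exact ((hII i j).sub ((hI i).const_mul _)).sub ((hI j).const_mul _)
    · exact integrable_const _
  have he : ∀ x : Fin d → ℝ, (∑ j, v j * (x j - m j)) ^ 2
      = ∑ i, ∑ j, v i * v j * ((x i - m i) * (x j - m j)) := by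
    intro x
    rw [sq, Finset.sum_mul_sum]
    refine Finset.sum_congr rfl fun i _ => Finset.sum_congr rfl fun j _ => by ring
  change Integrable (fun x : Fin d → ℝ => (∑ j, v j * (x j - m j)) ^ 2) μ ∧
    ∫ x, (∑ j, v j * (x j - m j)) ^ 2 ∂μ = ∑ j, v j ^ 2
  simp_rw [he]
  refine ⟨integrable_finsetSum _ fun i _ => integrable_finsetSum _ fun j _ =>
    (hII' i j).const_mul _, ?_⟩
  rw [integral_finsetSum _ fun i _ => integrable_finsetSum _ fun j _ => (hII' i j).const_mul _]
  refine Finset.sum_congr rfl fun i _ => ?_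
  rw [integral_finsetSum _ fun j _ => (hII' i j).const_mul _]
  simp_rw [integral_const_mul, hc]
  simp [sq]

lemma tail_two {d : ℕ} (μ : Measure (Fin d → ℝ)) [IsProbabilityMeasure μ] (h : IsLogConcave μ)
    (hcov : HasIdCovariance μ) (v : Fin d → ℝ) (hv : ∑ j, v j ^ 2 ≤ 1/64) (k : ℕ) :
    μ.real {x | 1/4 + (k:ℝ)/2 ≤ |∑ j, v j * (x j - ∫ y, y j ∂μ)|} ≤ 1/4 * (1/3) ^ k := by
  obtain ⟨hint, heq⟩ := second_moment μ hcov v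
  set c : ℝ := ∑ j, v j * ∫ y, y j ∂μ with hc
  have hZ : ∀ x : Fin d → ℝ, ∑ j, v j * (x j - ∫ y, y j ∂μ) = (∑ j, v j * x j) - c := by
    intro x
    rw [hc, ← Finset.sum_sub_distrib]
    exact Finset.sum_congr rfl fun j _ => by ring
  simp_rw [hZ] at *
  have hN : ∀ x : Fin d → ℝ, (∑ j, (-v) j * x j) - (-c) = -((∑ j, v j * x j) - c) := by
    intro x
    simp only [Pi.neg_apply, neg_mul, Finset.sum_neg_distrib]
    ring
  have t1 := tail_one μ h v c
  have t2 := tail_one μ h (-v) (-c)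
  simp_rw [hN] at t2
  have hmZ : Measurable fun x : Fin d → ℝ => (∑ j, v j * x j) - c := by fun_prop
  set Z : (Fin d → ℝ) → ℝ := fun x => (∑ j, v j * x j) - c with hZdef
  have cheb : μ.real {x | 1/4 ≤ Z x} + μ.real {x | 1/4 ≤ - Z x} ≤ 1/4 := by
    rw [← measureReal_union]
    · have h1 := mul_meas_ge_le_integral_of_nonneg (μ := μ) (f := fun x => Z x ^ 2)
        (Filter.Eventually.of_forall fun x => sq_nonneg _) hint (1/16)
      have h2 : μ.real ({x | 1/4 ≤ Z x} ∪ {x | 1/4 ≤ - Z x}) ≤ μ.real {x | 1/16 ≤ Z x ^ 2} := by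
        apply measureReal_mono _ (measure_ne_top _ _)
        rintro x (hx | hx)
        · simp only [Set.mem_ofPred_eq] at hx ⊢; nlinarith
        · simp only [Set.mem_ofPred_eq] at hx ⊢; nlinarith
      have h3 : ∫ x, Z x ^ 2 ∂μ ≤ 1/64 := heq.le.trans hv
      linarith
    · rw [Set.disjoint_left]
      intro x hx hx'
      simp only [Set.mem_ofPred_eq] at hx hx'
      linarith
    · exact measurableSet_le (by fun_prop) (by fun_prop)
  have p1 : (0:ℝ) ≤ μ.real {x | 1/4 ≤ Z x} := measureReal_nonneg
  have p2 : (0:ℝ) ≤ μ.real {x | 1/4 ≤ -Z x} := measureReal_nonneg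
  have c1 : 1 ≤ μ.real {x | -1/4 ≤ Z x} + μ.real {x | 1/4 ≤ - Z x} := by
    refine le_trans ?_ (measureReal_union_le _ _)
    refine (probReal_univ (μ := μ)).symm.le.trans ?_
    apply measureReal_mono _ (measure_ne_top _ _)
    intro x _
    by_cases hx : -1/4 ≤ Z x
    · exact Or.inl hx
    · right; simp only [Set.mem_ofPred_eq]; linarith
  have c2 : 1 ≤ μ.real {x | -1/4 ≤ -Z x} + μ.real {x | 1/4 ≤ Z x} := by
    refine le_trans ?_ (measureReal_union_le _ _)
    refine (probReal_univ (μ := μ)).symm.le.trans ?_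
    apply measureReal_mono _ (measure_ne_top _ _)
    intro x _
    by_cases hx : -1/4 ≤ -Z x
    · exact Or.inl hx
    · right; simp only [Set.mem_ofPred_eq]; linarith
  have t1' := t1 (by change 3 * μ.real {x | 1/4 ≤ Z x} ≤ μ.real {x | -1/4 ≤ Z x}; linarith) k
  have t2' := t2 (by change 3 * μ.real {x | 1/4 ≤ -Z x} ≤ μ.real {x | -1/4 ≤ -Z x}; linarith) k
  change μ.real {x | 1/4 + (k:ℝ)/2 ≤ Z x} ≤ μ.real {x | 1/4 ≤ Z x} * (1/3) ^ k at t1'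
  change μ.real {x | 1/4 + (k:ℝ)/2 ≤ -Z x} ≤ μ.real {x | 1/4 ≤ -Z x} * (1/3) ^ k at t2'
  have hu : μ.real {x | 1/4 + (k:ℝ)/2 ≤ |Z x|} ≤
      μ.real {x | 1/4 + (k:ℝ)/2 ≤ Z x} + μ.real {x | 1/4 + (k:ℝ)/2 ≤ -Z x} := by
    refine le_trans ?_ (measureReal_union_le _ _)
    apply measureReal_mono _ (measure_ne_top _ _)
    intro x hx
    simp only [Set.mem_ofPred_eq] at hx
    exact le_abs.1 hx
  have hp : (0:ℝ) ≤ (1/3)^k := by positivity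
  calc _ ≤ _ := hu
    _ ≤ (μ.real {x | 1/4 ≤ Z x} + μ.real {x | 1/4 ≤ -Z x}) * (1/3)^k := by linarith
    _ ≤ _ := by gcongr

lemma exp_frac_le (p q : ℕ) (hq : q ≠ 0) (c : ℝ) (hc : 0 ≤ c) (h : (2.7182818286:ℝ) ^ p ≤ c ^ q) :
    Real.exp ((p:ℝ) / q) ≤ c := by
  apply le_of_pow_le_pow_left₀ hq hc
  rw [← Real.exp_nat_mul, mul_div_cancel₀ _ (by exact_mod_cast hq)]
  refine le_trans ?_ h
  rw [show (p:ℝ) = p * 1 by ring, Real.exp_nat_mul]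
  exact pow_le_pow_left₀ (Real.exp_pos _).le Real.exp_one_lt_d9.le p

lemma exp_quad (z : ℝ) (h0 : 0 ≤ z) (h1 : z ≤ 13/4) : Real.exp z ≤ 17/16 + 8 * z ^ 2 := by
  have key : Real.exp z ≤ 1 + z + 4 * z ^ 2 := by
    by_cases a1 : z ≤ 1
    · have := Real.abs_exp_sub_one_sub_id_le (x := z) (by rw [abs_of_nonneg h0]; exact a1)
      have := (abs_le.1 this).2
      nlinarith [sq_nonneg z]
    by_cases a2 : z ≤ 17/10
    · have e := exp_frac_le 17 10 (by norm_num) 6 (by norm_num) (by norm_num)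
      have := Real.exp_le_exp.2 a2
      push_cast at e
      nlinarith
    by_cases a3 : z ≤ 13/5
    · have e := exp_frac_le 13 5 (by norm_num) 14 (by norm_num) (by norm_num)
      have := Real.exp_le_exp.2 a3
      push_cast at e
      nlinarith
    · have e := exp_frac_le 13 4 (by norm_num) 30 (by norm_num) (by norm_num)
      have := Real.exp_le_exp.2 h1
      push_cast at e
      nlinarith
  nlinarith [sq_nonneg (2 * z - 1/4)]

lemma exp_moment {d : ℕ} (μ : Measure (Fin d → ℝ)) [IsProbabilityMeasure μ] (h : IsLogConcave μ)
    (hcov : HasIdCovariance μ) (v : Fin d → ℝ) (hv : ∑ j, v j ^ 2 ≤ 1/64) :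
    ∫⁻ x, ENNReal.ofReal (Real.exp |∑ j, v j * (x j - ∫ y, y j ∂μ)|) ∂μ ≤ ENNReal.ofReal 1.225 := by
  obtain ⟨hint, heq⟩ := second_moment μ hcov v
  have htail := tail_two μ h hcov v hv
  have hmZ : Measurable fun x : Fin d → ℝ => ∑ j, v j * (x j - ∫ y, y j ∂μ) := by fun_prop
  set Z : (Fin d → ℝ) → ℝ := fun x => ∑ j, v j * (x j - ∫ y, y j ∂μ) with hZdef
  let A : ℕ → Set (Fin d → ℝ) := fun k => {x | 1/4 + ((k+6:ℕ):ℝ)/2 ≤ |Z x|}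
  have hA : ∀ k, MeasurableSet (A k) := fun k => measurableSet_le (by fun_prop) (by fun_prop)
  let c : ℕ → ℝ≥0∞ := fun k => ENNReal.ofReal (Real.exp (3/4 + ((k+6:ℕ):ℝ)/2))
  have hpt : ∀ x, ENNReal.ofReal (Real.exp |Z x|) ≤ ENNReal.ofReal (17/16 + 8 * Z x ^ 2) +
      ∑' k, (A k).indicator (fun _ => c k) x := by
    intro x
    by_cases hx : |Z x| ≤ 13/4
    · refine le_add_right (ENNReal.ofReal_le_ofReal ?_)
      have := exp_quad _ (abs_nonneg _) hx
      rwa [sq_abs] at this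
    · refine le_add_left ?_
      have hx' : 0 ≤ 2 * (|Z x| - 13/4) := by linarith
      set k := ⌊2 * (|Z x| - 13/4)⌋₊ with hk
      have hk1 := Nat.floor_le hx'
      have hk2 := Nat.lt_floor_add_one (2 * (|Z x| - 13/4))
      rw [← hk] at hk1 hk2
      refine le_trans ?_ (ENNReal.le_tsum k)
      rw [Set.indicator_of_mem]
      · apply ENNReal.ofReal_le_ofReal
        apply Real.exp_le_exp.2
        push_cast; linarith
      · simp only [A, Set.mem_ofPred_eq]
        push_cast; linarith
  have hterm : ∀ k, c k * μ (A k) ≤ ENNReal.ofReal (0.0148 * 0.55 ^ k) := by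
    intro k
    have h1 : μ (A k) ≤ ENNReal.ofReal (1/4 * (1/3) ^ (k+6)) := by
      rw [← ofReal_measureReal]
      exact ENNReal.ofReal_le_ofReal (htail (k+6))
    calc c k * μ (A k) ≤ c k * ENNReal.ofReal (1/4 * (1/3) ^ (k+6)) := by gcongr
      _ = ENNReal.ofReal (Real.exp (3/4 + ((k+6:ℕ):ℝ)/2) * (1/4 * (1/3) ^ (k+6))) := by
        rw [ENNReal.ofReal_mul (Real.exp_pos _).le]
      _ ≤ _ := by
        apply ENNReal.ofReal_le_ofReal
        have e1 := exp_frac_le 15 4 (by norm_num) 43 (by norm_num) (by norm_num)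
        have e2 := exp_frac_le 1 2 (by norm_num) 1.65 (by norm_num) (by norm_num)
        push_cast at e1 e2
        have e3 : Real.exp (3/4 + ((k+6:ℕ):ℝ)/2) = Real.exp (15/4) * Real.exp (1/2) ^ k := by
          rw [← Real.exp_nat_mul, ← Real.exp_add]
          congr 1
          push_cast; ring
        rw [e3]
        calc Real.exp (15/4) * Real.exp (1/2) ^ k * (1/4 * (1/3) ^ (k+6))
            ≤ 43 * 1.65 ^ k * (1/4 * (1/3) ^ (k+6)) := by gcongr
          _ = (43 / 2916) * 0.55 ^ k := by
            rw [show (0.55:ℝ) = 1.65 * (1/3) by norm_num, mul_pow]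
            ring
          _ ≤ _ := by gcongr; norm_num
  calc ∫⁻ x, ENNReal.ofReal (Real.exp |Z x|) ∂μ
      ≤ ∫⁻ x, (ENNReal.ofReal (17/16 + 8 * Z x ^ 2) +
        ∑' k, (A k).indicator (fun _ => c k) x) ∂μ := lintegral_mono hpt
    _ = ∫⁻ x, ENNReal.ofReal (17/16 + 8 * Z x ^ 2) ∂μ + ∑' k, c k * μ (A k) := by
      rw [lintegral_add_left (by fun_prop), lintegral_tsum
        (fun k => (measurable_const.indicator (hA k)).aemeasurable)]
      congr 2
      ext k
      rw [lintegral_indicator_const (hA k)]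
    _ ≤ ENNReal.ofReal (17/16 + 8 * (1/64)) + ∑' k, ENNReal.ofReal (0.0148 * 0.55 ^ k) := by
      apply add_le_add
      · rw [← ofReal_integral_eq_lintegral_ofReal]
        · apply ENNReal.ofReal_le_ofReal
          rw [integral_add (integrable_const _) (hint.const_mul _), integral_const_mul, heq]
          simp only [integral_const, probReal_univ, one_smul]
          linarith
        · exact (integrable_const _).add (hint.const_mul _)
        · exact Filter.Eventually.of_forall fun x => by positivity
      · exact ENNReal.tsum_le_tsum hterm
    _ = ENNReal.ofReal (17/16 + 8 * (1/64) + 0.0148 * (1 - 0.55)⁻¹) := by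
      rw [← ENNReal.ofReal_tsum_of_nonneg (fun k => by positivity), tsum_mul_left,
        tsum_geometric_of_lt_one (by norm_num) (by norm_num), ← ENNReal.ofReal_add]
      · norm_num
      · norm_num
      · exact (summable_geometric_of_lt_one (by norm_num) (by norm_num)).mul_left _
    _ ≤ _ := by
      apply ENNReal.ofReal_le_ofReal
      norm_num

def eball (d : ℕ) (r : ℝ) : Set (Fin d → ℝ) := {v | ∑ j, v j ^ 2 ≤ r ^ 2}

lemma eball_meas (d : ℕ) (r : ℝ) : MeasurableSet (eball d r) :=
  measurableSet_le (by fun_prop) (by fun_prop)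

lemma eball_pos (d : ℕ) (r : ℝ) (hr : 0 < r) : volume (eball d r) ≠ 0 := by
  have hopen : IsOpen {v : Fin d → ℝ | ∑ j, v j ^ 2 < r ^ 2} :=
    isOpen_lt (by fun_prop) (by fun_prop)
  have := hopen.measure_pos volume ⟨0, by simp; positivity⟩
  refine (this.trans_le (measure_mono ?_)).ne'
  intro v hv
  simp only [Set.mem_ofPred_eq] at hv
  exact hv.le

lemma eball_fin (d : ℕ) (r : ℝ) (hr : 0 < r) : volume (eball d r) ≠ ⊤ := by
  refine ne_top_of_le_ne_top (measure_closedBall_lt_top (x := (0 : Fin d → ℝ)) (r := r)).ne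
    (measure_mono ?_)
  intro v hv
  rw [mem_closedBall_zero_iff, pi_norm_le_iff_of_nonneg hr.le]
  intro j
  rw [Real.norm_eq_abs]
  apply abs_le_of_sq_le_sq _ hr.le
  exact (Finset.single_le_sum (f := fun j => v j ^ 2) (fun i _ => sq_nonneg _)
    (Finset.mem_univ j)).trans hv

open scoped Pointwise in
lemma eball_scale (d : ℕ) : volume (eball d (1/8)) = 10 ^ d * volume (eball d (1/80)) := by
  have : eball d (1/8) = (10:ℝ) • eball d (1/80) := by
    ext v
    rw [Set.mem_smul_set_iff_inv_smul_mem₀ (by norm_num)]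
    simp only [eball, Set.mem_ofPred_eq, Pi.smul_apply, smul_eq_mul, mul_pow, ← Finset.mul_sum]
    constructor <;> intro h <;> linarith
  rw [this, Measure.addHaar_smul]
  congr 1
  rw [abs_of_nonneg (by positivity), ENNReal.ofReal_pow (by norm_num)]
  simp

lemma eball_add (d : ℕ) (u v : Fin d → ℝ) (hu : ∑ j, u j ^ 2 = (9/80) ^ 2)
    (hv : v ∈ eball d (1/80)) : u + v ∈ eball d (1/8) := by
  simp only [eball, Set.mem_ofPred_eq] at hv ⊢
  have e : ∑ j, (u + v) j ^ 2 = ∑ j, u j ^ 2 + 2 * ∑ j, u j * v j + ∑ j, v j ^ 2 := by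
    rw [Finset.mul_sum, ← Finset.sum_add_distrib, ← Finset.sum_add_distrib]
    exact Finset.sum_congr rfl fun j _ => by simp only [Pi.add_apply]; ring
  have cs := Finset.sum_mul_sq_le_sq_mul_sq Finset.univ u v
  have : ∑ j, u j * v j ≤ 9/80 * (1/80) := by
    apply le_of_abs_le
    apply abs_le_of_sq_le_sq _ (by norm_num)
    rw [hu] at cs
    nlinarith
  rw [e, hu]
  nlinarith

lemma prod_bound (d n : ℕ) (μ : Fin n → Measure (Fin d → ℝ))
    [∀ i, IsProbabilityMeasure (μ i)]
    (hlc : ∀ i, IsLogConcave (μ i)) (hcov : ∀ i, HasIdCovariance (μ i))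
    (v : Fin d → ℝ) (hv : v ∈ eball d (1/8)) :
    ∫⁻ W, ENNReal.ofReal (Real.exp (∑ i, |∑ j, v j * (W i j - ∫ x, x j ∂(μ i))|)) ∂(Measure.pi μ)
      ≤ ENNReal.ofReal 1.225 ^ n := by
  have h1 : ∀ W : Fin n → Fin d → ℝ,
      ENNReal.ofReal (Real.exp (∑ i, |∑ j, v j * (W i j - ∫ x, x j ∂(μ i))|))
      = ∏ i, ENNReal.ofReal (Real.exp |∑ j, v j * (W i j - ∫ x, x j ∂(μ i))|) := by
    intro W
    rw [Real.exp_sum, ENNReal.ofReal_prod_of_nonneg fun i _ => (Real.exp_pos _).le]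
  simp_rw [h1]
  have hX : ∀ i, Measurable fun x : Fin d → ℝ =>
      ENNReal.ofReal (Real.exp |∑ j, v j * (x j - ∫ x, x j ∂(μ i))|) := fun i => by fun_prop
  have hind : iIndepFun (fun i (W : Fin n → Fin d → ℝ) =>
      ENNReal.ofReal (Real.exp |∑ j, v j * (W i j - ∫ x, x j ∂(μ i))|)) (Measure.pi μ) :=
    iIndepFun_pi (X := fun i (x : Fin d → ℝ) =>
      ENNReal.ofReal (Real.exp |∑ j, v j * (x j - ∫ x, x j ∂(μ i))|)) fun i => (hX i).aemeasurable
  rw [lintegral_prod_eq_prod_lintegral_of_indepFun Finset.univ _ hind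
    fun i => (hX i).comp (measurable_pi_apply i)]
  have : ∀ i ∈ Finset.univ, ∫⁻ W, ENNReal.ofReal (Real.exp |∑ j, v j * (W i j - ∫ x, x j ∂(μ i))|)
      ∂(Measure.pi μ) ≤ ENNReal.ofReal 1.225 := by
    intro i _
    have := (measurePreserving_eval μ i).lintegral_comp (hX i)
    refine this.le.trans (exp_moment (μ i) (hlc i) (hcov i) v ?_)
    refine le_trans hv (by norm_num)
  refine (Finset.prod_le_prod' this).trans ?_
  simp

lemma lower_bound (d n : ℕ) (m : Fin n → Fin d → ℝ) (W : Fin n → Fin d → ℝ)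
    (u : Fin d → ℝ) (hu : ∑ j, u j ^ 2 = 1)
    (hW : 4 * (n:ℝ) ≤ ∑ i, |∑ j, u j * (W i j - m i j)|) :
    ENNReal.ofReal (Real.exp (9/20 * n)) * volume (eball d (1/80))
      ≤ 2 * ∫⁻ v in eball d (1/8),
        ENNReal.ofReal (Real.exp (∑ i, |∑ j, v j * (W i j - m i j)|)) := by
  set F : (Fin d → ℝ) → ℝ := fun v => ∑ i, |∑ j, v j * (W i j - m i j)| with hF
  set u0 : Fin d → ℝ := (9/80:ℝ) • u with hu0
  have hu0n : ∑ j, u0 j ^ 2 = (9/80)^2 := by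
    simp only [hu0, Pi.smul_apply, smul_eq_mul, mul_pow, ← Finset.mul_sum, hu, mul_one]
  have hFm : Measurable fun v => ENNReal.ofReal (Real.exp (F v)) := by
    rw [hF]; fun_prop
  have hF0 : 9/20 * (n:ℝ) ≤ F u0 := by
    have : F u0 = 9/80 * ∑ i, |∑ j, u j * (W i j - m i j)| := by
      simp only [hF, hu0]
      rw [Finset.mul_sum]
      refine Finset.sum_congr rfl fun i _ => ?_
      rw [← abs_of_nonneg (show (0:ℝ) ≤ 9/80 by norm_num), ← abs_mul, Finset.mul_sum,
        abs_of_nonneg (show (0:ℝ) ≤ 9/80 by norm_num)]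
      congr 1
      refine Finset.sum_congr rfl fun j _ => ?_
      simp only [Pi.smul_apply, smul_eq_mul]; ring
    rw [this]; linarith
  have hconv : ∀ v, 2 * F u0 ≤ F (u0 + v) + F (u0 + -v) := by
    intro v
    simp only [hF]
    rw [← Finset.sum_add_distrib, Finset.mul_sum]
    refine Finset.sum_le_sum fun i _ => ?_
    have e : 2 * ∑ j, u0 j * (W i j - m i j) = ∑ j, (u0 + v) j * (W i j - m i j)
        + ∑ j, (u0 + -v) j * (W i j - m i j) := by
      rw [← Finset.sum_add_distrib, Finset.mul_sum]
      refine Finset.sum_congr rfl fun j _ => ?_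
      simp only [Pi.add_apply, Pi.neg_apply]; ring
    calc 2 * |∑ j, u0 j * (W i j - m i j)| = |2 * ∑ j, u0 j * (W i j - m i j)| := by
          rw [abs_mul]; norm_num
      _ ≤ _ := by rw [e]; exact abs_add_le _ _
  have hpt : ∀ v, ENNReal.ofReal (Real.exp (9/20 * n)) ≤
      ENNReal.ofReal (Real.exp (F (u0 + v))) + ENNReal.ofReal (Real.exp (F (u0 + -v))) := by
    intro v
    by_cases hc : F u0 ≤ F (u0 + v)
    · exact le_add_right (ENNReal.ofReal_le_ofReal (Real.exp_le_exp.2 (hF0.trans hc)))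
    · refine le_add_left (ENNReal.ofReal_le_ofReal (Real.exp_le_exp.2 (hF0.trans ?_)))
      have := hconv v
      linarith
  let G : (Fin d → ℝ) → ℝ≥0∞ := (eball d (1/8)).indicator fun v => ENNReal.ofReal (Real.exp (F v))
  have hneg : ∀ v, -v ∈ eball d (1/80) ↔ v ∈ eball d (1/80) := by
    intro v; simp [eball]
  have hpt2 : ∀ v, (eball d (1/80)).indicator (fun _ => ENNReal.ofReal (Real.exp (9/20 * n))) v
      ≤ G (u0 + v) + G (u0 + -v) := by
    intro v
    by_cases hv : v ∈ eball d (1/80)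
    · simp only [G]
      rw [Set.indicator_of_mem hv, Set.indicator_of_mem (eball_add d u0 v hu0n hv),
        Set.indicator_of_mem (eball_add d u0 (-v) hu0n ((hneg v).2 hv))]
      exact hpt v
    · rw [Set.indicator_of_notMem hv]; exact zero_le
  have hGm : Measurable G := hFm.indicator (eball_meas d _)
  rw [← lintegral_indicator_const (eball_meas d _), ← lintegral_indicator (eball_meas d _)]
  change _ ≤ 2 * ∫⁻ v, G v
  refine (lintegral_mono hpt2).trans ?_
  rw [lintegral_add_left (by fun_prop), lintegral_neg_eq_self (fun v => G (u0 + v)),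
    lintegral_add_left_eq_self, two_mul]

lemma numerics (d n : ℕ) (hd : 1 ≤ d) (hn : 100 * d ≤ n) :
    2 * 10 ^ d * (1.225:ℝ) ^ n ≤ Real.exp (9/20 * n) * Real.exp (-(n:ℝ) / 5) := by
  have h1 : (2:ℝ) * 10 ^ d ≤ 20 ^ d := by
    rw [show (20:ℝ) = 2 * 10 by norm_num, mul_pow]
    gcongr
    exact le_self_pow₀ (by norm_num) (by omega)
  have h2 : (20:ℝ) ^ d ≤ 1.04 ^ n := by
    calc (20:ℝ) ^ d ≤ (1.04 ^ 100) ^ d := by gcongr; norm_num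
      _ = 1.04 ^ (100 * d) := by rw [pow_mul]
      _ ≤ _ := pow_le_pow_right₀ (by norm_num) hn
  have h3 : (1.274:ℝ) ≤ Real.exp (1/4) := by
    have := Real.quadratic_le_exp_of_nonneg (x := 1/4) (by norm_num)
    norm_num at this ⊢; linarith
  calc 2 * 10 ^ d * (1.225:ℝ) ^ n ≤ 1.04 ^ n * 1.225 ^ n := by
        gcongr; exact h1.trans h2
    _ = 1.274 ^ n := by rw [← mul_pow]; norm_num
    _ ≤ Real.exp (1/4) ^ n := by gcongr
    _ = _ := by
      rw [← Real.exp_nat_mul, ← Real.exp_add]; congr 1; ring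

/-- for `n ≥ 100d` and a random matrix `W ∈ ℝ^{d×n}` with independent
logconcave identity-covariance columns,
`P[∃ unit vector u, Σᵢ |uᵀ(Wᵢ − E[Wᵢ])| ≥ 4n] ≤ e^{−n/5}`. -/
theorem stmt_16 (d n : ℕ) (hn : 100 * d ≤ n)
    (μ : Fin n → Measure (Fin d → ℝ))
    [∀ i, IsProbabilityMeasure (μ i)]
    (hlc : ∀ i, IsLogConcave (μ i)) (hcov : ∀ i, HasIdCovariance (μ i)) :
    (Measure.pi μ)
      {W : Fin n → Fin d → ℝ | ∃ u : Fin d → ℝ, (∑ j, u j ^ 2) = 1 ∧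
        4 * (n : ℝ) ≤ ∑ i, |∑ j, u j * (W i j - ∫ x, x j ∂(μ i))|}
      ≤ ENNReal.ofReal (Real.exp (-(n : ℝ) / 5)) := by
  rcases Nat.eq_zero_or_pos d with rfl | hd
  · simp
  set S := {W : Fin n → Fin d → ℝ | ∃ u : Fin d → ℝ, (∑ j, u j ^ 2) = 1 ∧
        4 * (n : ℝ) ≤ ∑ i, |∑ j, u j * (W i j - ∫ x, x j ∂(μ i))|} with hS
  let Φ : (Fin n → Fin d → ℝ) → (Fin d → ℝ) → ℝ≥0∞ := fun W v =>
    ENNReal.ofReal (Real.exp (∑ i, |∑ j, v j * (W i j - ∫ x, x j ∂(μ i))|))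
  have hΦ : Measurable (Function.uncurry Φ) := by
    simp only [Φ, Function.uncurry_def]
    fun_prop
  set β := volume (eball d (1/80)) with hβ
  have hβ0 : β ≠ 0 := eball_pos d _ (by norm_num)
  have hβt : β ≠ ⊤ := eball_fin d _ (by norm_num)
  set E := ENNReal.ofReal (Real.exp (9/20 * n)) with hE
  have hE0 : E ≠ 0 := by simp [hE, Real.exp_pos]
  have hEt : E ≠ ⊤ := ENNReal.ofReal_ne_top
  have hGm0 : Measurable fun W => ∫⁻ v in eball d (1/8), Φ W v :=
    Measurable.lintegral_prod_right' hΦ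
  have hGm : Measurable fun W => 2 * ∫⁻ v in eball d (1/8), Φ W v :=
    hGm0.const_mul 2
  have hSsub : S ⊆ {W | E * β ≤ 2 * ∫⁻ v in eball d (1/8), Φ W v} := by
    rintro W ⟨u, hu, hW⟩
    exact lower_bound d n (fun i j => ∫ x, x j ∂(μ i)) W u hu hW
  have hint : ∫⁻ W, (2 * ∫⁻ v in eball d (1/8), Φ W v) ∂(Measure.pi μ)
      ≤ 2 * (ENNReal.ofReal 1.225 ^ n * (10 ^ d * β)) := by
    rw [lintegral_const_mul _ hGm0]
    gcongr
    rw [lintegral_lintegral_swap hΦ.aemeasurable]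
    refine (setLIntegral_mono' (g := fun _ => ENNReal.ofReal 1.225 ^ n) (eball_meas d _)
      fun v hv => prod_bound d n μ hlc hcov v hv).trans ?_
    rw [setLIntegral_const, eball_scale]
  have hmain : (E * β) * (Measure.pi μ) S ≤ (E * β) * ENNReal.ofReal (Real.exp (-(n : ℝ) / 5)) := by
    calc (E * β) * (Measure.pi μ) S
        ≤ (E * β) * (Measure.pi μ) {W | E * β ≤ 2 * ∫⁻ v in eball d (1/8), Φ W v} := by gcongr
      _ ≤ _ := mul_meas_ge_le_lintegral hGm _
      _ ≤ _ := hint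
      _ = ENNReal.ofReal (2 * 10 ^ d * 1.225 ^ n) * β := by
        rw [ENNReal.ofReal_mul (by positivity), ENNReal.ofReal_mul (by positivity),
          ENNReal.ofReal_pow (by norm_num), ENNReal.ofReal_pow (by norm_num)]
        simp only [ENNReal.ofReal_ofNat]
        ring
      _ ≤ ENNReal.ofReal (Real.exp (9/20 * n) * Real.exp (-(n:ℝ) / 5)) * β := by
        exact mul_le_mul_left (ENNReal.ofReal_le_ofReal (numerics d n hd hn)) β
      _ = _ := by
        rw [ENNReal.ofReal_mul (Real.exp_pos _).le]; ring
  exact (ENNReal.mul_le_mul_iff_right (mul_ne_zero hE0 hβ0) (ENNReal.mul_ne_top hEt hβt)).1 hmain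
end

section
/- Let ω₁, …, ω_n be independent real logconcave random variables, each with mean 0 and variance 1. Then for every s ≥ 2: P[ Σ_{i=1}^n |ω_i| ≥ s·n ] ≤ e^{−n(s − 2 − log(s−1))}. -/
open MeasureTheory ProbabilityTheory

/-- A real random variable (with law `μ`) is logconcave if its law has a density `f ≥ 0`
w.r.t. Lebesgue measure such that `log f` is concave, i.e.
`f(x)^t · f(y)^{1−t} ≤ f(tx + (1−t)y)` for all `x, y` and `t ∈ [0,1]`. -/
def IsLogConcave1 (μ : Measure ℝ) : Prop :=
  ∃ f : ℝ → ℝ, (∀ x, 0 ≤ f x) ∧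
    μ = MeasureTheory.volume.withDensity (fun x => ENNReal.ofReal (f x)) ∧
    ∀ x y t : ℝ, 0 ≤ t → t ≤ 1 →
      f x ^ t * f y ^ (1 - t) ≤ f (t * x + (1 - t) * y)

/-- Rolle three times. -/
lemma cubic_coef_pos {l k0 k1 k2 K p q r s : ℝ} (hl : 0 < l) (hpq : p < q) (hqr : q < r)
    (hrs : r < s) (H : ∀ y ∈ ({p, q, r, s} : Set ℝ),
      Real.exp (l * y) - (k0 + k1 * y + k2 * y ^ 2 + K * y ^ 3) = 0) : 0 < K := by
  have d0 : ∀ y, HasDerivAt (fun y => Real.exp (l * y) - (k0 + k1 * y + k2 * y ^ 2 + K * y ^ 3))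
      (l * Real.exp (l * y) - (k1 + 2 * k2 * y + 3 * K * y ^ 2)) y := by
    intro y
    have h1 := (((hasDerivAt_id y).const_mul l).exp).sub
      (((((hasDerivAt_const y k0).add ((hasDerivAt_id y).const_mul k1)).add
        ((hasDerivAt_pow 2 y).const_mul k2))).add ((hasDerivAt_pow 3 y).const_mul K))
    refine h1.congr_deriv ?_
    simp; ring
  have d1 : ∀ y, HasDerivAt (fun y => l * Real.exp (l * y) - (k1 + 2 * k2 * y + 3 * K * y ^ 2))
      (l ^ 2 * Real.exp (l * y) - (2 * k2 + 6 * K * y)) y := by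
    intro y
    have h1 := ((((hasDerivAt_id y).const_mul l).exp).const_mul l).sub
      ((((hasDerivAt_const y k1).add ((hasDerivAt_id y).const_mul (2 * k2))).add
        ((hasDerivAt_pow 2 y).const_mul (3 * K))))
    refine h1.congr_deriv ?_
    simp; ring
  have d2 : ∀ y, HasDerivAt (fun y => l ^ 2 * Real.exp (l * y) - (2 * k2 + 6 * K * y))
      (l ^ 3 * Real.exp (l * y) - 6 * K) y := by
    intro y
    have h1 := ((((hasDerivAt_id y).const_mul l).exp).const_mul (l ^ 2)).sub
      (((hasDerivAt_const y (2 * k2)).add ((hasDerivAt_id y).const_mul (6 * K))))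
    refine h1.congr_deriv ?_
    simp; ring
  have rolle : ∀ (F F' : ℝ → ℝ), (∀ y, HasDerivAt F (F' y) y) → ∀ a b, a < b → F a = 0 → F b = 0 →
      ∃ c, a < c ∧ c < b ∧ F' c = 0 := by
    intro F F' hF a b hab ha hb
    obtain ⟨c, hc, h⟩ := exists_hasDerivAt_eq_zero hab
      (fun y _ => (hF y).continuousAt.continuousWithinAt) (ha.trans hb.symm) (fun y _ => hF y)
    exact ⟨c, hc.1, hc.2, h⟩
  obtain ⟨a1, _, _, h1⟩ := rolle _ _ d0 p q hpq (H p (by simp)) (H q (by simp))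
  obtain ⟨a2, _, _, h2⟩ := rolle _ _ d0 q r hqr (H q (by simp)) (H r (by simp))
  obtain ⟨a3, _, _, h3⟩ := rolle _ _ d0 r s hrs (H r (by simp)) (H s (by simp))
  obtain ⟨b1, _, _, e1⟩ := rolle _ _ d1 a1 a2 (by linarith) h1 h2
  obtain ⟨b2, _, _, e2⟩ := rolle _ _ d1 a2 a3 (by linarith) h2 h3
  obtain ⟨c, _, _, e⟩ := rolle _ _ d2 b1 b2 (by linarith) e1 e2
  have : 0 < l ^ 3 * Real.exp (l * c) := by positivity
  linarith

/-- Quadratic interpolation of the exponential with the sign of the error. -/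
lemma exists_quad {l a b c : ℝ} (hl : 0 < l) (hab : a < b) (hbc : b < c) :
    ∃ k0 k1 k2 : ℝ, ∀ x, ∃ K, 0 ≤ K ∧
      Real.exp (l * x) - (k0 + k1 * x + k2 * x ^ 2) = K * ((x - a) * (x - b) * (x - c)) := by
  have hba' : b - a ≠ 0 := by linarith
  have hca' : c - a ≠ 0 := by linarith
  have hcb' : c - b ≠ 0 := by linarith
  obtain ⟨A, hA⟩ : ∃ A, A * (b - a) = Real.exp (l * b) - Real.exp (l * a) :=
    ⟨_, div_mul_cancel₀ _ hba'⟩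
  obtain ⟨B, hB⟩ : ∃ B, B * ((c - a) * (c - b)) =
      Real.exp (l * c) - Real.exp (l * a) - A * (c - a) :=
    ⟨_, div_mul_cancel₀ _ (mul_ne_zero hca' hcb')⟩
  refine ⟨Real.exp (l * a) - A * a + B * a * b, A - B * (a + b), B, fun x => ?_⟩
  have ea : Real.exp (l * a) -
    ((Real.exp (l * a) - A * a + B * a * b) + (A - B * (a + b)) * a + B * a ^ 2) = 0 := by ring
  have eb : Real.exp (l * b) -
    ((Real.exp (l * a) - A * a + B * a * b) + (A - B * (a + b)) * b + B * b ^ 2) = 0 := by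
    linear_combination -hA
  have ec : Real.exp (l * c) -
    ((Real.exp (l * a) - A * a + B * a * b) + (A - B * (a + b)) * c + B * c ^ 2) = 0 := by
    linear_combination -hB
  generalize (Real.exp (l * a) - A * a + B * a * b) = k0 at *
  generalize A - B * (a + b) = k1 at *
  by_cases hxa : x = a
  · exact ⟨0, le_rfl, by subst hxa; simpa using ea⟩
  by_cases hxb : x = b
  · exact ⟨0, le_rfl, by subst hxb; simpa using eb⟩
  by_cases hxc : x = c
  · exact ⟨0, le_rfl, by subst hxc; simpa using ec⟩
  have hw : (x - a) * (x - b) * (x - c) ≠ 0 :=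
    mul_ne_zero (mul_ne_zero (sub_ne_zero.2 hxa) (sub_ne_zero.2 hxb)) (sub_ne_zero.2 hxc)
  obtain ⟨K, hK⟩ : ∃ K, K * ((x - a) * (x - b) * (x - c)) =
      Real.exp (l * x) - (k0 + k1 * x + B * x ^ 2) := ⟨_, div_mul_cancel₀ _ hw⟩
  refine ⟨K, ?_, hK.symm⟩
  have key : ∀ y, y = a ∨ y = b ∨ y = c ∨ y = x → Real.exp (l * y) - ((k0 - K * (a * b * c)) +
      (k1 + K * (a * b + b * c + a * c)) * y + (B - K * (a + b + c)) * y ^ 2 + K * y ^ 3) = 0 := by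
    rintro y (rfl | rfl | rfl | rfl)
    · linear_combination ea
    · linear_combination eb
    · linear_combination ec
    · linear_combination -hK
  apply le_of_lt
  rcases lt_or_gt_of_ne hxa with h1 | h1
  · exact cubic_coef_pos hl h1 hab hbc (fun y hy => key y (by simp at hy; tauto))
  rcases lt_or_gt_of_ne hxb with h2 | h2
  · exact cubic_coef_pos hl h1 h2 hbc (fun y hy => key y (by simp at hy; tauto))
  rcases lt_or_gt_of_ne hxc with h3 | h3
  · exact cubic_coef_pos hl hab h2 h3 (fun y hy => key y (by simp at hy; tauto))
  · exact cubic_coef_pos hl hab hbc h3 (fun y hy => key y (by simp at hy; tauto))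

/-- density of a centred exponential variable -/
noncomputable def expoG (x : ℝ) : ℝ := (Set.Ioi (-1 : ℝ)).indicator (fun x => Real.exp (-(x + 1))) x

lemma expoG_mul (h : ℝ → ℝ) : (fun x => expoG x * h x) =
    (Set.Ioi (-1 : ℝ)).indicator (fun x => Real.exp (-(x + 1)) * h x) := by
  funext x
  simp only [expoG, Set.indicator]
  split_ifs <;> simp

lemma tendsto_aux (a0 a1 a2 : ℝ) : Filter.Tendsto
    (fun x : ℝ => Real.exp (-(x + 1)) * (a0 + a1 * x + a2 * x ^ 2)) Filter.atTop (nhds 0) := by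
  have h0 := Real.tendsto_pow_mul_exp_neg_atTop_nhds_zero 0
  have h1 := Real.tendsto_pow_mul_exp_neg_atTop_nhds_zero 1
  have h2 := Real.tendsto_pow_mul_exp_neg_atTop_nhds_zero 2
  have := (((h0.const_mul a0).add (h1.const_mul a1)).add (h2.const_mul a2)).const_mul
    (Real.exp (-1))
  simp only [mul_zero, add_zero] at this
  refine this.congr (fun x => ?_)
  rw [neg_add, Real.exp_add]; ring

lemma deriv_aux (a0 a1 a2 x : ℝ) : HasDerivAt
    (fun x : ℝ => Real.exp (-(x + 1)) * (a0 + a1 * x + a2 * x ^ 2))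
    (Real.exp (-(x + 1)) * ((a1 - a0) + (2 * a2 - a1) * x - a2 * x ^ 2)) x := by
  have h1 := (((hasDerivAt_id x).add_const 1).neg.exp).mul
    (((hasDerivAt_const x a0).add ((hasDerivAt_id x).const_mul a1)).add
        ((hasDerivAt_pow 2 x).const_mul a2))
  refine h1.congr_deriv ?_
  simp; ring

lemma G_int0 : IntegrableOn (fun x : ℝ => Real.exp (-(x + 1))) (Set.Ioi (-1)) := by
  have := integrableOn_Ioi_deriv_of_nonneg' (a := -1) (fun x _ => deriv_aux (-1) 0 0 x)
    (fun x _ => by simp; positivity) (tendsto_aux (-1) 0 0)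
  simpa using this

lemma G_int2 : IntegrableOn (fun x : ℝ => Real.exp (-(x + 1)) * x ^ 2) (Set.Ioi (-1)) := by
  have := integrableOn_Ioi_deriv_of_nonneg' (a := -1) (fun x _ => deriv_aux (-2) (-2) (-1) x)
    (fun x _ => by ring_nf; positivity) (tendsto_aux (-2) (-2) (-1))
  simpa using this

lemma G_int1 : IntegrableOn (fun x : ℝ => Real.exp (-(x + 1)) * x) (Set.Ioi (-1)) := by
  refine (G_int0.add G_int2).mono' (by fun_prop) (Filter.Eventually.of_forall fun x => ?_)
  rw [norm_mul, Real.norm_of_nonneg (Real.exp_pos _).le, Real.norm_eq_abs]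
  have : |x| ≤ 1 + x ^ 2 := by
    rw [abs_le]; constructor <;> nlinarith [sq_nonneg (x - 1), sq_nonneg (x + 1)]
  simp only [Pi.add_apply]
  nlinarith [Real.exp_pos (-(x + 1))]

lemma G_quad (k0 k1 k2 : ℝ) :
    Integrable (fun x => expoG x * (k0 + k1 * x + k2 * x ^ 2)) ∧
    ∫ x, expoG x * (k0 + k1 * x + k2 * x ^ 2) = k0 + k2 := by
  have hI : IntegrableOn (fun x : ℝ => Real.exp (-(x + 1)) * (k0 + k1 * x + k2 * x ^ 2))
      (Set.Ioi (-1)) := by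
    have := ((G_int0.const_mul k0).add (G_int1.const_mul k1)).add (G_int2.const_mul k2)
    refine this.congr (Filter.Eventually.of_forall fun x => ?_)
    simp only [Pi.add_apply]; ring
  rw [expoG_mul]
  refine ⟨hI.integrable_indicator measurableSet_Ioi, ?_⟩
  rw [integral_indicator measurableSet_Ioi]
  have := integral_Ioi_of_hasDerivAt_of_tendsto' (a := -1)
    (fun x _ => (deriv_aux (-k0 - k1 - 2 * k2) (-k1 - 2 * k2) (-k2) x))
    (hI.congr (Filter.Eventually.of_forall fun x => by simp only []; ring)) (tendsto_aux _ _ _)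
  calc _ = _ := by
        congr 1; funext x; ring_nf
    _ = _ := this
    _ = _ := by simp; ring

lemma G_exp {l : ℝ} (hl1 : l < 1) :
    Integrable (fun x => expoG x * Real.exp (l * x)) ∧
    ∫ x, expoG x * Real.exp (l * x) = Real.exp (-l) / (1 - l) := by
  have e : ∀ x : ℝ, Real.exp (-(x + 1)) * Real.exp (l * x) =
      Real.exp (-1) * Real.exp ((l - 1) * x) := by
    intro x; rw [← Real.exp_add, ← Real.exp_add]; ring_nf
  rw [expoG_mul]
  simp_rw [e]
  refine ⟨IntegrableOn.integrable_indicator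
    ((integrableOn_exp_mul_Ioi (by linarith) _).const_mul _) measurableSet_Ioi, ?_⟩
  rw [integral_indicator measurableSet_Ioi, integral_const_mul,
    integral_exp_mul_Ioi (by linarith)]
  have : 1 - l ≠ 0 := by linarith
  have : l - 1 ≠ 0 := by linarith
  rw [show -l = -1 + (l - 1) * (-1) by ring, Real.exp_add]
  field_simp
  ring

lemma lc_between {f : ℝ → ℝ}
    (hlc : ∀ x y t : ℝ, 0 ≤ t → t ≤ 1 → f x ^ t * f y ^ (1 - t) ≤ f (t * x + (1 - t) * y))
    {A B x y z : ℝ} (hx : Real.exp (A * x + B) ≤ f x) (hy : Real.exp (A * y + B) ≤ f y)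
    (hxz : x ≤ z) (hzy : z ≤ y) : Real.exp (A * z + B) ≤ f z := by
  rcases eq_or_lt_of_le (hxz.trans hzy) with h | h
  · have : z = x := by linarith
    rwa [this]
  · have hyx : y - x ≠ 0 := by linarith
    have hyx' : 0 < y - x := by linarith
    have h0 : 0 ≤ (y - z) / (y - x) := div_nonneg (by linarith) hyx'.le
    have h1 : (y - z) / (y - x) ≤ 1 := (div_le_one hyx').2 (by linarith)
    have hz : (y - z) / (y - x) * x + (1 - (y - z) / (y - x)) * y = z := by
      field_simp; ring
    have := hlc x y _ h0 h1
    rw [hz] at this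
    refine le_trans ?_ this
    set t := (y - z) / (y - x)
    calc Real.exp (A * z + B) = Real.exp (A * x + B) ^ t * Real.exp (A * y + B) ^ (1 - t) := by
          rw [← Real.exp_mul, ← Real.exp_mul, ← Real.exp_add, ← hz]; ring_nf
      _ ≤ _ := by
          have h2 : 0 ≤ 1 - t := by linarith
          have h3 : 0 ≤ f x := (Real.exp_pos _).le.trans hx
          have h4 : 0 ≤ f x ^ t := Real.rpow_nonneg h3 t
          gcongr

lemma lc_measurable {f : ℝ → ℝ} (hf0 : ∀ x, 0 ≤ f x)
    (hlc : ∀ x y t : ℝ, 0 ≤ t → t ≤ 1 → f x ^ t * f y ^ (1 - t) ≤ f (t * x + (1 - t) * y)) :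
    Measurable f := by
  refine measurable_of_Ici fun a => ?_
  rcases le_or_gt a 0 with ha | ha
  · have : f ⁻¹' Set.Ici a = Set.univ := by
      ext x; simp; exact ha.trans (hf0 x)
    rw [this]; exact MeasurableSet.univ
  · apply Set.OrdConnected.measurableSet
    refine ⟨fun x hx y hy z hz => ?_⟩
    have := lc_between hlc (A := 0) (B := Real.log a) (x := x) (y := y) (z := z)
    simp only [zero_mul, zero_add, Real.exp_log ha] at this
    exact this hx hy hz.1 hz.2

lemma expoG_nonneg (x : ℝ) : 0 ≤ expoG x :=
  Set.indicator_nonneg (fun _ _ => (Real.exp_pos _).le) x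

lemma expoG_left {x : ℝ} (h : x ≤ -1) : expoG x = 0 := by
  simp [expoG, h]

/-- Trichotomy of the sign pattern of `f - expoG`. -/
lemma pattern {f : ℝ → ℝ} (hf0 : ∀ x, 0 ≤ f x)
    (hlc : ∀ x y t : ℝ, 0 ≤ t → t ≤ 1 → f x ^ t * f y ^ (1 - t) ≤ f (t * x + (1 - t) * y)) :
    (∃ b c : ℝ, -1 < b ∧ b < c ∧ ∀ x, (f x - expoG x) * ((x - (-1)) * (x - b) * (x - c)) ≤ 0) ∨
    (∃ k0 k1 k2 : ℝ, (∀ᵐ x : ℝ, k0 + k1 * x + k2 * x ^ 2 ≠ 0) ∧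
      ∀ᵐ x : ℝ, 0 ≤ (f x - expoG x) * (k0 + k1 * x + k2 * x ^ 2)) := by
  have hne : ∀ r : ℝ, ∀ᵐ x : ℝ, x ≠ r := fun r => by
    simp [ae_iff]
  set I : Set ℝ := {x | -1 < x ∧ expoG x ≤ f x} with hI
  have hG : ∀ x, -1 < x → expoG x = Real.exp (-1 * x + -1) := fun x hx => by
    simp [expoG, hx]; ring_nf
  have hconv : ∀ x ∈ I, ∀ y ∈ I, ∀ z, x ≤ z → z ≤ y → z ∈ I := by
    rintro x ⟨hx, hx'⟩ y ⟨hy, hy'⟩ z hxz hzy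
    have hz : -1 < z := by linarith
    refine ⟨hz, ?_⟩
    rw [hG _ hz]; rw [hG _ hx] at hx'; rw [hG _ hy] at hy'
    exact lc_between hlc hx' hy' hxz hzy
  have hneg : ∀ x, x ≤ -1 → 0 ≤ f x - expoG x := fun x hx => by
    rw [expoG_left hx]; simpa using hf0 x
  have hin : ∀ x ∈ I, 0 ≤ f x - expoG x := fun x hx => sub_nonneg.2 hx.2
  have hout : ∀ x, -1 < x → x ∉ I → f x - expoG x ≤ 0 := fun x hx hxI => by
    by_contra h
    exact hxI ⟨hx, by linarith⟩
  rcases Set.eq_empty_or_nonempty I with hE | hN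
  · right
    refine ⟨-1, -1, 0, ?_, ?_⟩
    · filter_upwards [hne (-1)] with x hx h
      exact hx (by linarith)
    · refine Filter.Eventually.of_forall fun x => ?_
      rcases le_or_gt x (-1) with h | h
      · exact mul_nonneg (hneg x h) (by linarith)
      · exact mul_nonneg_of_nonpos_of_nonpos (hout x h (by simp [hE])) (by linarith)
  have hbb : BddBelow I := ⟨-1, fun x hx => hx.1.le⟩
  set b := sInf I with hb
  have hb1 : -1 ≤ b := le_csInf hN fun x hx => hx.1.le
  have hltb : ∀ x, x < b → x ∉ I := fun x hx hxI => absurd (csInf_le hbb hxI) (not_le.2 hx)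
  by_cases hba : BddAbove I
  · set c := sSup I with hc
    have hbc : b ≤ c := (csInf_le hbb hN.some_mem).trans (le_csSup hba hN.some_mem)
    have hgtc : ∀ x, c < x → x ∉ I := fun x hx hxI => absurd (le_csSup hba hxI) (not_le.2 hx)
    have hmid : ∀ x, b < x → x < c → x ∈ I := fun x h1 h2 => by
      obtain ⟨y, hy, hyx⟩ := exists_lt_of_csInf_lt hN h1
      obtain ⟨z, hz, hxz⟩ := exists_lt_of_lt_csSup hN h2
      exact hconv y hy z hz x hyx.le hxz.le
    have main : ∀ x, (f x - expoG x) * ((x - (-1)) * (x - b) * (x - c)) ≤ 0 := by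
      intro x
      rcases le_or_gt x (-1) with h | h
      · refine mul_nonpos_of_nonneg_of_nonpos (hneg x h) ?_
        exact mul_nonpos_of_nonneg_of_nonpos
          (mul_nonneg_of_nonpos_of_nonpos (by linarith) (by linarith)) (by linarith)
      rcases lt_trichotomy x b with h2 | h2 | h2
      · refine mul_nonpos_of_nonpos_of_nonneg (hout x h (hltb x h2)) ?_
        exact mul_nonneg_of_nonpos_of_nonpos
          (mul_nonpos_of_nonneg_of_nonpos (by linarith) (by linarith)) (by linarith)
      · rw [h2]; simp
      rcases lt_trichotomy x c with h3 | h3 | h3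
      · refine mul_nonpos_of_nonneg_of_nonpos (hin x (hmid x h2 h3)) ?_
        exact mul_nonpos_of_nonneg_of_nonpos
          (mul_nonneg (by linarith) (by linarith)) (by linarith)
      · rw [h3]; simp
      · refine mul_nonpos_of_nonpos_of_nonneg (hout x h (hgtc x h3)) ?_
        exact mul_nonneg (mul_nonneg (by linarith) (by linarith)) (by linarith)
    rcases eq_or_lt_of_le hb1 with hb2 | hb2
    · right
      refine ⟨c, -1, 0, ?_, ?_⟩
      · filter_upwards [hne c] with x hx h
        exact hx (by linarith)
      · filter_upwards [hne (-1)] with x hx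
        have h1 := main x
        rw [← hb2] at h1
        have h2 : 0 < (x - (-1)) ^ 2 := by
          have : x - (-1) ≠ 0 := sub_ne_zero.2 hx
          positivity
        by_contra! h3
        nlinarith [mul_pos_of_neg_of_neg h3 (neg_lt_zero.2 h2)]
    rcases eq_or_lt_of_le hbc with hc2 | hc2
    · right
      refine ⟨-1, -1, 0, ?_, ?_⟩
      · filter_upwards [hne (-1)] with x hx h
        exact hx (by linarith)
      · filter_upwards [hne b] with x hx
        have h1 := main x
        rw [← hc2] at h1
        have h2 : 0 < (x - b) ^ 2 := by
          have : x - b ≠ 0 := sub_ne_zero.2 hx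
          positivity
        by_contra! h3
        nlinarith [mul_pos_of_neg_of_neg h3 (neg_lt_zero.2 h2)]
    left
    exact ⟨b, c, hb2, hc2, main⟩
  · right
    have hgtb : ∀ x, b < x → x ∈ I := fun x h1 => by
      obtain ⟨y, hy, hyx⟩ := exists_lt_of_csInf_lt hN h1
      obtain ⟨z, hz, hxz⟩ := not_bddAbove_iff.1 hba x
      exact hconv y hy z hz x hyx.le hxz.le
    have e : ∀ x : ℝ, -b + (1 - b) * x + 1 * x ^ 2 = (x - (-1)) * (x - b) := fun x => by ring
    refine ⟨-b, 1 - b, 1, ?_, ?_⟩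
    · filter_upwards [hne b, hne (-1)] with x hx hx'
      rw [e]
      exact mul_ne_zero (sub_ne_zero.2 hx') (sub_ne_zero.2 hx)
    · refine Filter.Eventually.of_forall fun x => ?_
      rw [e]
      rcases le_or_gt x (-1) with h | h
      · exact mul_nonneg (hneg x h)
          (mul_nonneg_of_nonpos_of_nonpos (by linarith) (by linarith))
      rcases lt_trichotomy x b with h2 | h2 | h2
      · exact mul_nonneg_of_nonpos_of_nonpos (hout x h (hltb x h2))
          (mul_nonpos_of_nonneg_of_nonpos (by linarith) (by linarith))
      · rw [h2]; simp
      · exact mul_nonneg (hin x (hgtb x h2)) (mul_nonneg (by linarith) (by linarith))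

lemma f_quad {f : ℝ → ℝ} (i0 : Integrable f) (i1 : Integrable fun x => f x * x)
    (i2 : Integrable fun x => f x * x ^ 2) (e0 : ∫ x, f x = 1) (e1 : ∫ x, f x * x = 0)
    (e2 : ∫ x, f x * x ^ 2 = 1) (k0 k1 k2 : ℝ) :
    Integrable (fun x => f x * (k0 + k1 * x + k2 * x ^ 2)) ∧
    ∫ x, f x * (k0 + k1 * x + k2 * x ^ 2) = k0 + k2 := by
  have e : (fun x => f x * (k0 + k1 * x + k2 * x ^ 2)) =
      fun x => (k0 * f x + k1 * (f x * x)) + k2 * (f x * x ^ 2) := by funext x; ring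
  rw [e]
  have j0 := i0.const_mul k0
  have j1 := i1.const_mul k1
  have j2 := i2.const_mul k2
  refine ⟨(j0.add j1).add j2, ?_⟩
  have j01 : Integrable (fun x => k0 * f x + k1 * (f x * x)) := j0.add j1
  rw [integral_add j01 j2, integral_add j0 j1, integral_const_mul, integral_const_mul,
    integral_const_mul, e0, e1, e2]
  ring

/-- Moment generating function comparison with the centred exponential. -/
lemma mgf_comparison {f : ℝ → ℝ} (hf0 : ∀ x, 0 ≤ f x)
    (hlc : ∀ x y t : ℝ, 0 ≤ t → t ≤ 1 → f x ^ t * f y ^ (1 - t) ≤ f (t * x + (1 - t) * y))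
    (i0 : Integrable f) (i1 : Integrable fun x => f x * x)
    (i2 : Integrable fun x => f x * x ^ 2) (e0 : ∫ x, f x = 1) (e1 : ∫ x, f x * x = 0)
    (e2 : ∫ x, f x * x ^ 2 = 1) {l : ℝ} (hl : 0 < l) (hl1 : l < 1) :
    Integrable (fun x => f x * Real.exp (l * x)) ∧
    ∫ x, f x * Real.exp (l * x) ≤ Real.exp (-l) / (1 - l) := by
  obtain ⟨gi, ge⟩ := G_exp hl1
  have fq := f_quad i0 i1 i2 e0 e1 e2
  rcases pattern hf0 hlc with ⟨b, c, hb, hc, hbc⟩ | ⟨k0, k1, k2, hk, hd⟩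
  · obtain ⟨k0, k1, k2, hq⟩ := exists_quad hl hb hc
    obtain ⟨fi, fe⟩ := fq k0 k1 k2
    obtain ⟨qi, qe⟩ := G_quad k0 k1 k2
    have hpt : ∀ x, f x * Real.exp (l * x) ≤ f x * (k0 + k1 * x + k2 * x ^ 2)
        + expoG x * Real.exp (l * x) - expoG x * (k0 + k1 * x + k2 * x ^ 2) := by
      intro x
      obtain ⟨K, hK, h⟩ := hq x
      have h2 := mul_nonpos_of_nonneg_of_nonpos hK (hbc x)
      have : (f x - expoG x) * (Real.exp (l * x) - (k0 + k1 * x + k2 * x ^ 2)) ≤ 0 := by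
        rw [h]; linarith
      linarith
    have hi : Integrable (fun x => f x * Real.exp (l * x)) := by
      refine ((fi.add gi).sub qi).mono' (i0.aestronglyMeasurable.mul (by fun_prop))
        (Filter.Eventually.of_forall fun x => ?_)
      rw [Real.norm_of_nonneg (mul_nonneg (hf0 x) (Real.exp_pos _).le)]
      exact hpt x
    refine ⟨hi, ?_⟩
    have := integral_mono hi ((fi.add gi).sub qi) hpt
    rw [integral_sub' (fi.add gi) qi, integral_add' fi gi, fe, ge, qe] at this
    linarith
  · have h0 : ∀ᵐ x : ℝ, f x = expoG x := by
      obtain ⟨fi, fe⟩ := fq k0 k1 k2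
      obtain ⟨qi, qe⟩ := G_quad k0 k1 k2
      have e : (fun x => (f x - expoG x) * (k0 + k1 * x + k2 * x ^ 2)) =
        (fun x => f x * (k0 + k1 * x + k2 * x ^ 2)) -
          fun x => expoG x * (k0 + k1 * x + k2 * x ^ 2) := by
        funext x; simp only [Pi.sub_apply]; ring
      have hi : Integrable (fun x => (f x - expoG x) * (k0 + k1 * x + k2 * x ^ 2)) := by
        rw [e]; exact fi.sub qi
      have hz : ∫ x, (f x - expoG x) * (k0 + k1 * x + k2 * x ^ 2) = 0 := by
        rw [e, integral_sub' fi qi, fe, qe]; ring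
      have := (integral_eq_zero_iff_of_nonneg_ae hd hi).1 hz
      filter_upwards [this, hk] with x hx hx'
      have := (mul_eq_zero.1 hx).resolve_right hx'
      linarith
    have h1 : (fun x => expoG x * Real.exp (l * x)) =ᵐ[volume]
        fun x => f x * Real.exp (l * x) := by
      filter_upwards [h0] with x hx
      rw [hx]
    refine ⟨gi.congr h1, ?_⟩
    rw [← integral_congr_ae h1, ge]

/-- Exponential moment of the absolute value. -/
lemma abs_mgf {μ : Measure ℝ} [IsProbabilityMeasure μ] (h : IsLogConcave1 μ)
    (hmean : ∫ x, x ∂μ = 0) (hvar : ∫ x, x ^ 2 ∂μ = 1) {l : ℝ} (hl : 0 < l) (hl1 : l < 1) :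
    Integrable (fun x => Real.exp (l * |x|)) μ ∧
    ∫ x, Real.exp (l * |x|) ∂μ ≤ Real.exp l / (1 - l) := by
  obtain ⟨f, hf0, hμ, hlc⟩ := h
  have hm := lc_measurable hf0 hlc
  have hm' : Measurable (fun x => ENNReal.ofReal (f x)) := hm.ennreal_ofReal
  have tI : ∀ φ : ℝ → ℝ, Integrable φ μ ↔ Integrable (fun x => f x * φ x) := by
    intro φ
    rw [hμ, integrable_withDensity_iff_integrable_smul' hm' (by simp)]
    simp only [ENNReal.toReal_ofReal (hf0 _), smul_eq_mul]
  have tE : ∀ φ : ℝ → ℝ, ∫ x, φ x ∂μ = ∫ x, f x * φ x := by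
    intro φ
    rw [hμ, integral_withDensity_eq_integral_toReal_smul hm' (by simp)]
    simp only [ENNReal.toReal_ofReal (hf0 _), smul_eq_mul]
  have I2 : Integrable (fun x : ℝ => x ^ 2) μ := by
    by_contra hn
    rw [integral_undef hn] at hvar; norm_num at hvar
  have I0 : Integrable (fun _ : ℝ => (1 : ℝ)) μ := integrable_const _
  have I1 : Integrable (fun x : ℝ => x) μ := by
    refine (I0.add I2).mono' (by fun_prop) (Filter.Eventually.of_forall fun x => ?_)
    simp only [Pi.add_apply, Real.norm_eq_abs]
    rw [abs_le]; constructor <;> nlinarith [sq_nonneg (x - 1), sq_nonneg (x + 1)]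
  have E0 : ∫ _x : ℝ, (1 : ℝ) ∂μ = 1 := by simp
  have i0 : Integrable f := by simpa using (tI _).1 I0
  have i1 := (tI _).1 I1
  have i2 := (tI _).1 I2
  have e0 : ∫ x, f x = 1 := by rw [tE] at E0; simpa using E0
  have e1 := hmean; rw [tE] at e1
  have e2 := hvar; rw [tE] at e2
  obtain ⟨p1, p2⟩ := mgf_comparison hf0 hlc i0 i1 i2 e0 e1 e2 hl hl1
  have hneg : Integrable (fun x => f (-x) * Real.exp (l * x)) ∧
      ∫ x, f (-x) * Real.exp (l * x) ≤ Real.exp (-l) / (1 - l) := by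
    refine mgf_comparison (f := fun x => f (-x)) (fun x => hf0 _) ?_ i0.comp_neg ?_ ?_ ?_ ?_ ?_
      hl hl1
    · intro x y t h0 h1
      have := hlc (-x) (-y) t h0 h1
      rwa [show t * -x + (1 - t) * -y = -(t * x + (1 - t) * y) by ring] at this
    · simpa using i1.comp_neg.neg
    · simpa using i2.comp_neg
    · rw [integral_neg_eq_self (fun x => f x)]; exact e0
    · have := integral_neg_eq_self (fun x => f x * x) volume
      rw [e1] at this
      simpa [integral_neg] using this
    · have := integral_neg_eq_self (fun x => f x * x ^ 2) volume
      rw [e2] at this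
      simpa using this
  obtain ⟨q1, q2⟩ := hneg
  have q1' : Integrable (fun x => f x * Real.exp (-(l * x))) := by
    simpa using q1.comp_neg
  have q2' : ∫ x, f x * Real.exp (-(l * x)) ≤ Real.exp (-l) / (1 - l) := by
    have := integral_neg_eq_self (fun x => f x * Real.exp (-(l * x))) volume
    rw [← this]; simpa using q2
  rw [← tE] at p2 q2'
  rw [← tI] at p1 q1'
  have hab : Integrable (fun x : ℝ => |x|) μ := I1.abs
  have hEabs : ∫ x, |x| ∂μ ≤ 1 := by
    have : ∫ x, |x| ∂μ ≤ ∫ x, (1 + x ^ 2) / 2 ∂μ := by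
      refine integral_mono hab ((I0.add I2).div_const 2) fun x => ?_
      simp only
      nlinarith [sq_nonneg (|x| - 1), sq_abs x]
    rw [integral_div, integral_add I0 I2, E0, hvar] at this
    linarith
  have nI : Integrable (fun x : ℝ => Real.exp (-(l * |x|))) μ := by
    refine I0.mono' (by fun_prop) (Filter.Eventually.of_forall fun x => ?_)
    rw [Real.norm_of_nonneg (Real.exp_pos _).le, Real.exp_le_one_iff]
    have := abs_nonneg x
    nlinarith
  have nE : Real.exp (-l) ≤ ∫ x, Real.exp (-(l * |x|)) ∂μ := by
    have hlow : ∫ x, Real.exp (-l) * ((1 + l) - l * |x|) ∂μ ≤ ∫ x, Real.exp (-(l * |x|)) ∂μ := by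
      refine integral_mono (((integrable_const _).sub (hab.const_mul l)).const_mul _) nI
        fun x => ?_
      have h1 := Real.add_one_le_exp (l - l * |x|)
      have h2 : Real.exp (-(l * |x|)) = Real.exp (-l) * Real.exp (l - l * |x|) := by
        rw [← Real.exp_add]; ring_nf
      simp only
      rw [h2]
      exact mul_le_mul_of_nonneg_left (by linarith) (Real.exp_pos _).le
    rw [integral_const_mul, integral_sub (integrable_const _) (hab.const_mul l),
      integral_const_mul] at hlow
    simp only [integral_const, probReal_univ, one_smul] at hlow
    refine le_trans ?_ hlow
    have : 1 ≤ 1 + l - l * ∫ x, |x| ∂μ := by nlinarith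
    nlinarith [Real.exp_pos (-l)]
  have ident : (fun x : ℝ => Real.exp (l * |x|)) = fun x =>
      Real.exp (l * x) + Real.exp (-(l * x)) - Real.exp (-(l * |x|)) := by
    funext x
    rcases abs_cases x with ⟨h, _⟩ | ⟨h, _⟩ <;> rw [h] <;> ring_nf
  rw [ident]
  refine ⟨(p1.add q1').sub nI, ?_⟩
  have pq : Integrable (fun x => Real.exp (l * x) + Real.exp (-(l * x))) μ := p1.add q1'
  rw [integral_sub pq nI, integral_add p1 q1']
  have h1l : 0 < 1 - l := by linarith
  have : 2 * (Real.exp (-l) / (1 - l)) - Real.exp (-l) ≤ Real.exp l / (1 - l) := by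
    have e : 2 * (Real.exp (-l) / (1 - l)) - Real.exp (-l)
        = (Real.exp (-l) * (1 + l)) / (1 - l) := by field_simp; ring
    rw [e]
    gcongr
    have h1 : Real.exp l = Real.exp (-l) * Real.exp (2 * l) := by
      rw [← Real.exp_add]; ring_nf
    rw [h1]
    gcongr
    linarith [Real.add_one_le_exp (2 * l)]
  linarith

/-- if `ω₁, …, ωₙ` are independent logconcave real random variables with
mean `0` and variance `1`, then for every `s ≥ 2`,
`P[Σᵢ |ωᵢ| ≥ s·n] ≤ e^{−n(s − 2 − log(s−1))}`. -/
theorem stmt_17 (n : ℕ) (μ : Fin n → Measure ℝ)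
    [∀ i, IsProbabilityMeasure (μ i)]
    (hlc : ∀ i, IsLogConcave1 (μ i))
    (hmean : ∀ i, ∫ x, x ∂(μ i) = 0) (hvar : ∀ i, ∫ x, x ^ 2 ∂(μ i) = 1)
    (s : ℝ) (hs : 2 ≤ s) :
    (Measure.pi μ) {w | s * n ≤ ∑ i, |w i|}
      ≤ ENNReal.ofReal (Real.exp (-(n : ℝ) * (s - 2 - Real.log (s - 1)))) := by
  rcases eq_or_lt_of_le hs with rfl | hs2
  · norm_num
    exact prob_le_one
  have hs1 : 0 < s - 1 := by linarith
  obtain ⟨l, hl⟩ : ∃ l, l = (s - 2) / (s - 1) := ⟨_, rfl⟩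
  have hl0 : 0 < l := by rw [hl]; exact div_pos (by linarith) hs1
  have h1l : 1 - l = 1 / (s - 1) := by rw [hl]; field_simp; ring
  have hl1 : l < 1 := by
    have : 0 < 1 / (s - 1) := by positivity
    linarith
  have A := fun i => abs_mgf (hlc i) (hmean i) (hvar i) hl0 hl1
  have prodE : ∀ w : Fin n → ℝ, Real.exp (l * ∑ i, |w i|) = ∏ i, Real.exp (l * |w i|) := by
    intro w; rw [Finset.mul_sum, Real.exp_sum]
  have hI : Integrable (fun w : Fin n → ℝ => Real.exp (l * ∑ i, |w i|)) (Measure.pi μ) := by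
    simp_rw [prodE]
    exact Integrable.fintype_prod (f := fun _ x => Real.exp (l * |x|)) (fun i => (A i).1)
  have C := measure_ge_le_exp_mul_mgf (μ := Measure.pi μ)
    (X := fun w : Fin n → ℝ => ∑ i, |w i|) (s * n) hl0.le hI
  have M : mgf (fun w : Fin n → ℝ => ∑ i, |w i|) (Measure.pi μ) l
      ≤ (Real.exp l / (1 - l)) ^ n := by
    unfold mgf
    simp_rw [prodE]
    rw [integral_fintype_prod_eq_prod (fun (_ : Fin n) x => Real.exp (l * |x|))]
    calc _ ≤ ∏ _i : Fin n, Real.exp l / (1 - l) :=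
          Finset.prod_le_prod (fun i _ => integral_nonneg fun x => (Real.exp_pos _).le)
            (fun i _ => (A i).2)
      _ = _ := by rw [Finset.prod_const, Finset.card_univ, Fintype.card_fin]
  rw [← ofReal_measureReal]
  apply ENNReal.ofReal_le_ofReal
  refine C.trans ((mul_le_mul_of_nonneg_left M (Real.exp_pos _).le).trans (le_of_eq ?_))
  have e1 : Real.exp l / (1 - l) = Real.exp (l + Real.log (s - 1)) := by
    rw [Real.exp_add, Real.exp_log hs1, h1l]; field_simp
  rw [e1, ← Real.exp_nat_mul, ← Real.exp_add]
  congr 1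
  have e2 : l * (s - 1) = s - 2 := by rw [hl]; field_simp
  linear_combination (-(n : ℝ)) * e2
end
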